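/- Let K be a quadratic field and let (x,y) ∈ K × K satisfy y² = −(x−2)(x−3)(x³−x²−16x+29) with x ∉ ℚ. Then one of the following holds: x²+5x−15 = 0 and y = ±(17x−36); x²+3x−19 = 0 and y = ±(11x−34); x²−5x+7 = 0 and y = ±(3x−8); or 9x²−47x+59 = 0 and y = ±(x+2)/27. Conversely, every pair (x,y) ∈ K × K satisfying one of these four sets of conditions satisfies y² = −(x−2)(x−3)(x³−x²−16x+29) and x ∉ ℚ. -/

import Mathlib

/-- The quadratic map `z ↦ z ^ 2 + c`. -/
def fc {K : Type*} [Field K] (c : K) : K → K := fun z => z ^ 2 + c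

/-- `α` has exact period `m` under `fc c`. -/
def HasExactPeriod {K : Type*} [Field K] (c : K) (m : ℕ) (α : K) : Prop :=
  (fc c)^[m] α = α ∧ ∀ j : ℕ, 1 ≤ j → j < m → (fc c)^[j] α ≠ α

/-- `α` has preperiodic type `m_n` under `fc c`: preperiod exactly `n`, eventual period `m`. -/
def HasPreperiodicType {K : Type*} [Field K] (c : K) (m n : ℕ) (α : K) : Prop :=
  HasExactPeriod c m ((fc c)^[n] α) ∧ (fc c)^[n + m - 1] α ≠ (fc c)^[n - 1] α

section

open Polynomial NumberField

section SepticSubfield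

theorem isIntegral_int_coords {R : Type*} [CommRing R] {z : R} (hz : IsIntegral ℤ z) (i j k : ℤ) :
    IsIntegral ℤ ((i : R) + j * z + k * z ^ 2) := by
  have hi (n : ℤ) : IsIntegral ℤ (n : R) := isIntegral_algebraMap (R := ℤ) (x := n)
  exact ((hi i).add ((hi j).mul hz)).add ((hi k).mul (hz.pow 2))

theorem exists_unit_coe_eq {L : Type*} [Field L] {x y : L} (hx : IsIntegral ℤ x)
    (hy : IsIntegral ℤ y) (hxy : x * y = 1) : ∃ u : (𝓞 L)ˣ, (u : L) = x :=
  ⟨⟨⟨x, hx⟩, ⟨y, hy⟩, RingOfIntegers.ext hxy, RingOfIntegers.ext ((mul_comm y x).trans hxy)⟩,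
    rfl⟩

variable {L : Type*} [Field L] [NumberField L] (B : PowerBasis ℚ L)

/-- The minimal polynomial of `2 * cos (2 * π / 7) - 2`. -/
noncomputable def septicPoly : ℤ[X] := X ^ 3 + C 7 * X ^ 2 + C 14 * X + C 7

theorem septicPoly_monic : septicPoly.Monic := by
  unfold septicPoly; monicity!

theorem septicPoly_natDegree : septicPoly.natDegree = 3 := by
  unfold septicPoly; compute_degree!

theorem septicPoly_isEisensteinAt : septicPoly.IsEisensteinAt (Submodule.span ℤ {(7 : ℤ)}) := by
  refine septicPoly_monic.isEisensteinAt_of_mem_of_notMem ?_ ?_ ?_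
  · rw [Ne, Ideal.submodule_span_eq, Ideal.span_singleton_eq_top, Int.isUnit_iff]; norm_num
  · intro n hn
    rw [septicPoly_natDegree] at hn
    rw [Ideal.submodule_span_eq, Ideal.mem_span_singleton]
    unfold septicPoly
    interval_cases n <;> simp [coeff_X]
  · rw [Ideal.submodule_span_eq, Ideal.span_singleton_pow, Ideal.mem_span_singleton, septicPoly]
    simp [coeff_X]

theorem septicPoly_irreducible : Irreducible septicPoly := by
  refine septicPoly_isEisensteinAt.irreducible ?_ septicPoly_monic.isPrimitive ?_
  · rw [Ideal.submodule_span_eq, Ideal.span_singleton_prime (by norm_num)]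
    exact Nat.prime_iff_prime_int.mp (by norm_num : Nat.Prime 7)
  · rw [septicPoly_natDegree]; norm_num

theorem isIntegral_gen (hB : minpoly ℤ B.gen = septicPoly) :
    IsIntegral ℤ B.gen := by
  by_contra h
  rw [minpoly.eq_zero h] at hB
  exact septicPoly_monic.ne_zero hB.symm

theorem minpoly_rat_gen (hB : minpoly ℤ B.gen = septicPoly) :
    minpoly ℚ B.gen = septicPoly.map (algebraMap ℤ ℚ) := by
  rw [← hB]
  exact minpoly.isIntegrallyClosed_eq_field_fractions' ℚ (isIntegral_gen B hB)

theorem dim_eq_three (hB : minpoly ℤ B.gen = septicPoly) :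
    B.dim = 3 := by
  rw [← B.natDegree_minpoly, minpoly_rat_gen B hB, septicPoly_monic.natDegree_map,
    septicPoly_natDegree]

theorem gen_relation (hB : minpoly ℤ B.gen = septicPoly) :
    B.gen ^ 3 + 7 * B.gen ^ 2 + 14 * B.gen + 7 = 0 := by
  have := minpoly.aeval ℤ B.gen
  rw [hB] at this
  simpa [septicPoly, map_ofNat (aeval (R := ℤ) B.gen) 7, map_ofNat (aeval (R := ℤ) B.gen) 14]
    using this

theorem coords_unique (hB : minpoly ℤ B.gen = septicPoly) {i j k : ℚ}
    (h : (i : L) + j * B.gen + k * B.gen ^ 2 = 0) : i = 0 ∧ j = 0 ∧ k = 0 := by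
  have hd := dim_eq_three B hB
  have hli := Fintype.linearIndependent_iff.1 B.basis.linearIndependent
    (fun m => ![i, j, k] (Fin.cast hd m)) (by
      rw [← (finCongr hd.symm).sum_comp]
      simp [Fin.sum_univ_three, B.basis_eq_pow, Algebra.smul_def, h])
  refine ⟨?_, ?_, ?_⟩
  · simpa using hli (Fin.cast hd.symm 0)
  · simpa using hli (Fin.cast hd.symm 1)
  · simpa using hli (Fin.cast hd.symm 2)

theorem norm_gen (hB : minpoly ℤ B.gen = septicPoly) :
    Algebra.norm ℚ B.gen = -7 := by
  rw [Algebra.PowerBasis.norm_gen_eq_coeff_zero_minpoly, minpoly_rat_gen B hB, coeff_map,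
    show B.dim = 3 from dim_eq_three B hB]
  simp [septicPoly]
  norm_num

theorem discr_basis (hB : minpoly ℤ B.gen = septicPoly) :
    Algebra.discr ℚ B.basis = 49 ∨ Algebra.discr ℚ B.basis = -49 := by
  have hrel := gen_relation B hB
  have hπ := isIntegral_gen B hB
  obtain ⟨u, hu⟩ := exists_unit_coe_eq (isIntegral_int_coords hπ 17 12 2)
    (isIntegral_int_coords hπ 5 8 2) (by push_cast; linear_combination (4 * B.gen + 12) * hrel)
  have hd : aeval B.gen (minpoly ℚ B.gen).derivative = u * B.gen ^ 2 := by
    rw [hu, minpoly_rat_gen B hB]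
    simp [septicPoly, map_ofNat (aeval (R := ℚ) B.gen) 7, map_ofNat (aeval (R := ℚ) B.gen) 14]
    linear_combination (-2 * B.gen + 2) * hrel
  have hn := NumberField.Units.norm L u
  rw [Algebra.discr_powerBasis_eq_norm, hd, map_mul, map_pow, norm_gen B hB]
  rw [abs_eq (by norm_num)] at hn
  have hfin : Module.finrank ℚ L = 3 := by rw [B.finrank, dim_eq_three B hB]
  rw [hfin]
  rcases hn with h | h <;> rw [h] <;> norm_num

theorem exists_int_coords_gen (hB : minpoly ℤ B.gen = septicPoly) {z : L} (hz : IsIntegral ℤ z) :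
    ∃ i j k : ℤ, z = i + j * B.gen + k * B.gen ^ 2 := by
  have hπ := isIntegral_gen B hB
  have h1 := Algebra.discr_mul_isIntegral_mem_adjoin ℚ hπ hz
  have h2 : (7 : ℤ) ^ 2 • z ∈ Algebra.adjoin ℤ ({B.gen} : Set L) := by
    rcases discr_basis B hB with h | h <;> rw [h] at h1
    · convert h1 using 1
      simp [Algebra.smul_def]
    · convert neg_mem h1 using 1
      simp [Algebra.smul_def]
  have h3 := mem_adjoin_of_smul_prime_pow_smul_of_minpoly_isEisensteinAt
    (Nat.prime_iff_prime_int.mp (by norm_num : Nat.Prime 7)) hπ hz h2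
    (hB ▸ septicPoly_isEisensteinAt)
  rw [Algebra.adjoin_singleton_eq_range_aeval] at h3
  obtain ⟨f, rfl⟩ := h3
  have h4 := hπ.mem_span_pow ⟨f, rfl⟩
  rw [Submodule.mem_span_range_iff_exists_fun] at h4
  obtain ⟨c, hc⟩ := h4
  have hd : (minpoly ℤ B.gen).natDegree = 3 := by rw [hB, septicPoly_natDegree]
  refine ⟨c (Fin.cast hd.symm 0), c (Fin.cast hd.symm 1), c (Fin.cast hd.symm 2), ?_⟩
  change aeval B.gen f = _
  rw [← hc, ← (finCongr hd.symm).sum_comp]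
  simp [Fin.sum_univ_three]

theorem abs_discr_eq (hB : minpoly ℤ B.gen = septicPoly) :
    |NumberField.discr L| = 49 := by
  have hπ := isIntegral_gen B hB
  have hd := dim_eq_three B hB
  have key : Algebra.discr ℚ B.basis = NumberField.discr L := by
    rw [NumberField.coe_discr]
    apply Algebra.discr_eq_discr_of_toMatrix_coeff_isIntegral
    · intro m n
      rw [Module.Basis.toMatrix_apply]
      obtain ⟨i, j, k, h⟩ := exists_int_coords_gen B hB
        (z := integralBasis L n)
        (by rw [integralBasis_apply]; exact RingOfIntegers.isIntegral_coe _)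
      have : integralBasis L n = ∑ m, (![(i : ℚ), j, k] (Fin.cast hd m)) • B.basis m := by
        rw [h, ← (finCongr hd.symm).sum_comp]
        simp [Fin.sum_univ_three, B.basis_eq_pow, Algebra.smul_def]
      rw [this, B.basis.repr_sum_self]
      have hi (n : ℤ) : IsIntegral ℤ (n : ℚ) := isIntegral_algebraMap (R := ℤ) (x := n)
      generalize Fin.cast hd m = m'
      fin_cases m' <;> simp [hi]
    · intro m n
      rw [Module.Basis.toMatrix_apply, B.basis_eq_pow]
      have := integralBasis_repr_apply L (⟨B.gen ^ (n : ℕ), hπ.pow n⟩ : 𝓞 L) m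
      erw [this]
      exact isIntegral_algebraMap
  have : (NumberField.discr L : ℚ) = (49 : ℤ) ∨ (NumberField.discr L : ℚ) = (-49 : ℤ) := by
    rw [← key]; simpa using discr_basis B hB
  rcases this with h | h <;> rw [Int.cast_injective h] <;> norm_num

theorem isPrincipalIdealRing_ringOfIntegers (hB : minpoly ℤ B.gen = septicPoly) :
    IsPrincipalIdealRing (𝓞 L) := by
  apply RingOfIntegers.isPrincipalIdealRing_of_abs_discr_lt
  have hfin : Module.finrank ℚ L = 3 := by rw [B.finrank, dim_eq_three B hB]
  have hc := InfinitePlace.card_add_two_mul_card_eq_rank L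
  rw [hfin] at hc
  rw [abs_discr_eq B hB, hfin]
  have h3 := Real.pi_gt_d2
  have h4 := Real.pi_lt_d2
  have hle : InfinitePlace.nrComplexPlaces L ≤ 1 := by omega
  norm_num [Nat.factorial]
  interval_cases InfinitePlace.nrComplexPlaces L
  · norm_num
  · nlinarith

end SepticSubfield

section TotallyPositiveUnits

theorem exists_real_root_Ioo {p q : ℝ} (hpq : p < q)
    (h : (p ^ 3 + p ^ 2 - 2 * p - 1) * (q ^ 3 + q ^ 2 - 2 * q - 1) < 0) :
    ∃ r : ℝ, p < r ∧ r < q ∧ r ^ 3 + r ^ 2 - 2 * r - 1 = 0 := by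
  have hc : ContinuousOn (fun r : ℝ => r ^ 3 + r ^ 2 - 2 * r - 1) (Set.Icc p q) := by fun_prop
  rcases mul_neg_iff.1 h with ⟨h1, h2⟩ | ⟨h1, h2⟩
  · obtain ⟨r, hr, h0⟩ := intermediate_value_Ioo' hpq.le hc ⟨h2, h1⟩
    exact ⟨r, hr.1, hr.2, h0⟩
  · obtain ⟨r, hr, h0⟩ := intermediate_value_Ioo hpq.le hc ⟨h1, h2⟩
    exact ⟨r, hr.1, hr.2, h0⟩

theorem exists_real_embedding {L : Type*} [Field L] [NumberField L] (B : PowerBasis ℚ L)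
    (hB : minpoly ℤ B.gen = septicPoly) {r : ℝ} (hr : r ^ 3 + r ^ 2 - 2 * r - 1 = 0) :
    ∃ σ : L →+* ℝ, σ (B.gen + 2) = r := by
  refine ⟨(B.lift (r - 2) ?_ : L →ₐ[ℚ] ℝ), ?_⟩
  · rw [minpoly_rat_gen B hB]
    simp [septicPoly, map_ofNat (aeval (R := ℚ) (r - 2)) 7,
      map_ofNat (aeval (R := ℚ) (r - 2)) 14]
    linear_combination hr
  · simp [map_ofNat (B.lift (r - 2) _) 2]

/-- The three real embeddings of the cubic field of conductor `7`, separated by the image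
of `η = 2 * cos (2 * π / 7)`. -/
structure RealPlaces {L : Type*} [Field L] (η : L) where
  /-- the embeddings -/
  σ : Fin 3 → (L →+* ℝ)
  lower₀ : 1.2469 < σ 0 η
  upper₀ : σ 0 η < 1.25
  lower₁ : -0.4452 < σ 1 η
  upper₁ : σ 1 η < -0.44
  lower₂ : -1.803 < σ 2 η
  upper₂ : σ 2 η < -1.80

theorem nonempty_realPlaces {L : Type*} [Field L] [NumberField L] (B : PowerBasis ℚ L)
    (hB : minpoly ℤ B.gen = septicPoly) : Nonempty (RealPlaces (B.gen + 2)) := by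
  obtain ⟨r₀, h₀, h₀', e₀⟩ := exists_real_root_Ioo (p := 1.2469) (q := 1.25) (by norm_num)
    (by norm_num)
  obtain ⟨r₁, h₁, h₁', e₁⟩ := exists_real_root_Ioo (p := -0.4452) (q := -0.44) (by norm_num)
    (by norm_num)
  obtain ⟨r₂, h₂, h₂', e₂⟩ := exists_real_root_Ioo (p := -1.803) (q := -1.80) (by norm_num)
    (by norm_num)
  obtain ⟨σ₀, s₀⟩ := exists_real_embedding B hB e₀
  obtain ⟨σ₁, s₁⟩ := exists_real_embedding B hB e₁
  obtain ⟨σ₂, s₂⟩ := exists_real_embedding B hB e₂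
  exact ⟨⟨![σ₀, σ₁, σ₂], by simpa [s₀] using h₀, by simpa [s₀] using h₀', by simpa [s₁] using h₁,
    by simpa [s₁] using h₁', by simpa [s₂] using h₂, by simpa [s₂] using h₂'⟩⟩

variable {L : Type*} [Field L] {η : L}

theorem isIntegral_of_cubic (hη : η ^ 3 + η ^ 2 - 2 * η - 1 = 0) : IsIntegral ℤ η := by
  refine ⟨X ^ 3 + X ^ 2 - 2 * X - 1, by monicity!, ?_⟩
  simpa [eval₂_ofNat] using hη

theorem exists_unit_of_signs (hη : η ^ 3 + η ^ 2 - 2 * η - 1 = 0) (P : RealPlaces η)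
    (s : Fin 3 → Bool) : ∃ u : (𝓞 L)ˣ, ∀ i, 0 < P.σ i u ↔ s i = true := by
  have hi := isIntegral_of_cubic hη
  obtain ⟨u, hu⟩ := exists_unit_coe_eq hi (isIntegral_int_coords hi (-2) 1 1)
    (by push_cast; linear_combination hη)
  obtain ⟨w, hw⟩ := exists_unit_coe_eq (isIntegral_int_coords hi 1 1 0)
    (isIntegral_int_coords hi 2 0 (-1)) (by push_cast; linear_combination -hη)
  have hw' : (w : L) = 1 + η := by rw [hw]; push_cast; ring
  have := P.lower₀
  have := P.upper₀
  have := P.lower₁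
  have := P.upper₁
  have := P.lower₂
  have := P.upper₂
  have a0 : 0 < P.σ 0 u := by rw [hu]; linarith
  have a1 : P.σ 1 u < 0 := by rw [hu]; linarith
  have a2 : P.σ 2 u < 0 := by rw [hu]; linarith
  have b0 : 0 < P.σ 0 w := by rw [hw', map_add, map_one]; linarith
  have b1 : 0 < P.σ 1 w := by rw [hw', map_add, map_one]; linarith
  have b2 : P.σ 2 w < 0 := by rw [hw', map_add, map_one]; linarith
  have c0 := mul_pos a0 b0
  have c1 := mul_neg_of_neg_of_pos a1 b1
  have c2 := mul_pos_of_neg_of_neg a2 b2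
  clear hu hw hw'
  cases h0 : s 0 <;> cases h1 : s 1 <;> cases h2 : s 2
  · exact ⟨-1, by intro i; fin_cases i <;> simp [*]⟩
  · exact ⟨-w, by intro i; fin_cases i <;> simp [*] <;> linarith⟩
  · exact ⟨-(u * w), by intro i; fin_cases i <;> simp [*] <;> linarith⟩
  · exact ⟨-u, by intro i; fin_cases i <;> simp [*]; linarith⟩
  · exact ⟨u, by intro i; fin_cases i <;> simp [*] <;> linarith⟩
  · exact ⟨u * w, by intro i; fin_cases i <;> simp [*]; linarith⟩
  · exact ⟨w, by intro i; fin_cases i <;> simp [*]; linarith⟩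
  · exact ⟨1, by intro i; fin_cases i <;> simp [*]⟩

variable [NumberField L]

/-- A system of representatives of the units modulo squares. -/
noncomputable def unitRep (t : Bool × (Fin (Units.rank L) → Bool)) : (𝓞 L)ˣ :=
  (if t.1 then -1 else 1) * ∏ i, if t.2 i then Units.fundSystem L i else 1

theorem exists_unitRep_mul_sq (h3 : Module.finrank ℚ L = 3) (u : (𝓞 L)ˣ) :
    ∃ t w, u = unitRep t * w ^ 2 := by
  obtain ⟨⟨ζ, e⟩, h, -⟩ := Units.exist_unique_eq_mul_prod L u
  have hsplit (i) : ∃ b : Bool, ∃ w : (𝓞 L)ˣ,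
      Units.fundSystem L i ^ e i = (if b then Units.fundSystem L i else 1) * w ^ 2 := by
    rcases Int.even_or_odd' (e i) with ⟨k, hk | hk⟩
    · exact ⟨false, Units.fundSystem L i ^ k, by rw [hk, mul_comm 2 k, zpow_mul]; simp⟩
    · refine ⟨true, Units.fundSystem L i ^ k, ?_⟩
      rw [hk, zpow_add, mul_comm 2 k, zpow_mul, mul_comm]; simp
  choose b w hbw using hsplit
  have hprod : ∏ i, Units.fundSystem L i ^ e i =
      (∏ i, if b i then Units.fundSystem L i else 1) * (∏ i, w i) ^ 2 := by
    rw [Finset.prod_congr rfl fun i _ => hbw i, Finset.prod_mul_distrib, Finset.prod_pow]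
  rcases Units.torsion_eq_one_or_neg_one_of_odd_finrank (by rw [h3]; decide) ζ with hζ | hζ
  · refine ⟨(false, b), ∏ i, w i, ?_⟩
    simp only [hζ, hprod] at h
    simpa [unitRep] using h
  · refine ⟨(true, b), ∏ i, w i, ?_⟩
    simp only [hζ, hprod] at h
    simpa [unitRep] using h

theorem unit_eq_sq_of_totallyPositive (h3 : Module.finrank ℚ L = 3)
    (hη : η ^ 3 + η ^ 2 - 2 * η - 1 = 0) (P : RealPlaces η) (u : (𝓞 L)ˣ)
    (hu : ∀ i, 0 < P.σ i u) : ∃ w : (𝓞 L)ˣ, u = w ^ 2 := by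
  classical
  let g : Bool × (Fin (Units.rank L) → Bool) → (Fin 3 → Bool) :=
    fun t i => decide (0 < P.σ i (unitRep t : (𝓞 L)ˣ))
  have hsq (t) (w : (𝓞 L)ˣ) (i) :
      0 < P.σ i ((unitRep t * w ^ 2 : (𝓞 L)ˣ) : 𝓞 L) ↔ g t i = true := by
    have : 0 < (P.σ i (w : L)) ^ 2 := by
      have : P.σ i (w : L) ≠ 0 := by simp
      positivity
    simp [g, mul_pos_iff_of_pos_right this]
  have hsurj : Function.Surjective g := by
    intro s
    obtain ⟨u, hu⟩ := exists_unit_of_signs hη P s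
    obtain ⟨t, w, rfl⟩ := exists_unitRep_mul_sq h3 u
    refine ⟨t, funext fun i => ?_⟩
    rw [Bool.eq_iff_iff, ← hsq t w i, hu i]
  have hrank : Units.rank L ≤ 2 := by
    have hc := InfinitePlace.card_add_two_mul_card_eq_rank L
    rw [h3] at hc
    rw [Units.rank, InfinitePlace.card_eq_nrRealPlaces_add_nrComplexPlaces]
    omega
  have hcard : Fintype.card (Bool × (Fin (Units.rank L) → Bool)) ≤
      Fintype.card (Fin 3 → Bool) := by
    simp only [Fintype.card_prod, Fintype.card_bool, Fintype.card_pi, Finset.prod_const,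
      Finset.card_univ, Fintype.card_fin]
    calc 2 * 2 ^ Units.rank L ≤ 2 * 2 ^ 2 := by gcongr; norm_num
      _ = 2 ^ 3 := by norm_num
  have hinj : Function.Injective g :=
    ((Fintype.bijective_iff_surjective_and_card g).2
      ⟨hsurj, hcard.antisymm (Fintype.card_le_of_surjective g hsurj)⟩).1
  obtain ⟨t, w, rfl⟩ := exists_unitRep_mul_sq h3 u
  have h0 : unitRep (L := L) (false, fun _ => false) = 1 := by simp [unitRep]
  have : t = (false, fun _ => false) := by
    apply hinj
    funext i
    rw [Bool.eq_iff_iff, ← hsq t w i]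
    exact iff_of_true (hu i) (by simp [g, h0])
  exact ⟨w, by rw [this, h0, one_mul]⟩

end TotallyPositiveUnits

section TwoTorsionCurve

theorem IsCoprime.sub_mul_sub_mul_of_isUnit {R : Type*} [CommRing R] {m d a b : R}
    (hmd : IsCoprime m d) (hab : IsUnit (b - a)) : IsCoprime (m - a * d) (m - b * d) := by
  have h1 : IsCoprime (m - a * d) d := by
    have := hmd.add_mul_left_left (-a)
    rwa [show m + d * -a = m - a * d by ring] at this
  have h2 : IsCoprime (m - a * d) ((b - a) * d) :=
    (isCoprime_mul_unit_left_right hab _ _).2 h1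
  have h3 := h2.neg_right.add_mul_left_right 1
  rwa [show -((b - a) * d) + (m - a * d) * 1 = m - b * d by ring] at h3

/-- If the differences of the roots of `(X - a) (X - b) (X - c)` are units, then a value which is
a nonzero square has factors which are units times squares. -/
theorem exists_unit_mul_sq_of_sq_eq {R L : Type*} [CommRing R] [IsDomain R]
    [IsPrincipalIdealRing R] [Field L] [Algebra R L] [IsFractionRing R L] {a b c : R}
    (hab : IsUnit (b - a)) (hac : IsUnit (c - a)) {X V : L}
    (h : V ^ 2 = (X - algebraMap R L a) * (X - algebraMap R L b) * (X - algebraMap R L c)) :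
    ∃ (u : Rˣ) (r : L), X - algebraMap R L a = algebraMap R L u * r ^ 2 := by
  classical
  set m := IsFractionRing.num R X
  set d : R := (IsFractionRing.den R X : R)
  have hcop : IsCoprime m d := (IsFractionRing.num_den_reduced R X).isCoprime
  have hd0 : d ≠ 0 := nonZeroDivisors.coe_ne_zero _
  have hd : algebraMap R L d ≠ 0 := by
    rwa [Ne, FaithfulSMul.algebraMap_eq_zero_iff]
  have hX : X * algebraMap R L d = algebraMap R L m := by
    have := IsFractionRing.mk'_num_den R X
    rw [IsLocalization.mk'_eq_iff_eq_mul] at this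
    exact this.symm
  have hsub (e : R) : algebraMap R L (m - e * d) = (X - algebraMap R L e) * algebraMap R L d := by
    rw [map_sub, map_mul, ← hX]; ring
  have hsq : (V * algebraMap R L d ^ 2) ^ 2 =
      algebraMap R L ((m - a * d) * ((m - b * d) * (m - c * d) * d)) := by
    simp only [map_mul, hsub]
    linear_combination (algebraMap R L d) ^ 4 * h
  obtain ⟨k, hk⟩ := IsIntegrallyClosed.exists_algebraMap_eq_of_isIntegral_pow (R := R)
    (n := 2) (by norm_num) (by rw [hsq]; exact isIntegral_algebraMap)
  rw [← hk, ← map_pow] at hsq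
  replace hsq := FaithfulSMul.algebraMap_injective R L hsq
  have cd (e : R) : IsCoprime (m - e * d) d := by
    have := hcop.add_mul_left_left (-e)
    rwa [show m + d * -e = m - e * d by ring] at this
  have c1 : IsCoprime (m - a * d) ((m - b * d) * (m - c * d) * d) :=
    ((hcop.sub_mul_sub_mul_of_isUnit hab).mul_right
      (hcop.sub_mul_sub_mul_of_isUnit hac)).mul_right (cd a)
  have c2 : IsCoprime d ((m - a * d) * (m - b * d) * (m - c * d)) :=
    (((cd a).mul_left (cd b)).mul_left (cd c)).symm
  obtain ⟨p, u, hu⟩ := exists_associated_pow_of_mul_eq_pow' c1 hsq.symm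
  obtain ⟨q, w, hw⟩ := exists_associated_pow_of_mul_eq_pow' c2 (c := k) (k := 2)
    (by rw [hsq]; ring)
  have hq : algebraMap R L q ≠ 0 := by
    rw [Ne, FaithfulSMul.algebraMap_eq_zero_iff]
    rintro rfl
    exact hd0 (by rw [← hw]; ring)
  refine ⟨u * w⁻¹, algebraMap R L p / algebraMap R L q, ?_⟩
  have e1 := congrArg (algebraMap R L) hu
  have e2 := congrArg (algebraMap R L) hw
  have e3 : algebraMap R L w * algebraMap R L (w⁻¹ : Rˣ) = 1 := by rw [← map_mul]; simp
  rw [hsub, map_mul, map_pow] at e1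
  rw [map_mul, map_pow] at e2
  rw [Units.val_mul, map_mul]
  field_simp
  apply mul_right_cancel₀ (mul_ne_zero hd (by rw [← isUnit_iff_ne_zero]; exact w.isUnit.map _ :
    algebraMap R L w ≠ 0))
  linear_combination -(algebraMap R L w * algebraMap R L q ^ 2) * e1
    + algebraMap R L p ^ 2 * algebraMap R L u * e2
    - algebraMap R L p ^ 2 * algebraMap R L u * algebraMap R L d * e3

variable {F : Type*} [Field F]

/-- The `X`-coordinate of the double of a point with `X`-coordinate `X` on
`V ^ 2 = (X - a) (X - b) (X - c)`. -/
def dup (a b c X : F) : F :=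
  (X ^ 4 - 2 * (a * b + b * c + c * a) * X ^ 2 + 8 * (a * b * c) * X
    + (a * b + b * c + c * a) ^ 2 - 4 * (a + b + c) * (a * b * c))
    / (4 * ((X - a) * (X - b) * (X - c)))

theorem dup_rotate (a b c X : F) : dup b c a X = dup a b c X := by
  unfold dup; congr 1 <;> ring

theorem dup_sub [CharZero F] {a b c X : F} (h : (X - a) * (X - b) * (X - c) ≠ 0) :
    dup a b c X - a =
      ((X - a) ^ 2 - (a - b) * (a - c)) ^ 2 / (4 * ((X - a) * (X - b) * (X - c))) := by
  rw [dup, div_sub' (mul_ne_zero (by norm_num) h)]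
  congr 1; ring

/-- Translation by the point `(a, 0)`. -/
theorem exists_translate [CharZero F] {a b c X V : F} (hab : a ≠ b) (hac : a ≠ c) (hV : V ≠ 0)
    (h : V ^ 2 = (X - a) * (X - b) * (X - c)) :
    ∃ X' V' : F, V' ≠ 0 ∧ V' ^ 2 = (X' - a) * (X' - b) * (X' - c) ∧
      dup a b c X' = dup a b c X ∧ X' = a + (a - b) * (a - c) / (X - a) := by
  have h0 : (X - a) * (X - b) * (X - c) ≠ 0 := by rw [← h]; exact pow_ne_zero 2 hV
  have ha : X - a ≠ 0 := left_ne_zero_of_mul (left_ne_zero_of_mul h0)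
  have hb : X - b ≠ 0 := right_ne_zero_of_mul (left_ne_zero_of_mul h0)
  have hc : X - c ≠ 0 := right_ne_zero_of_mul h0
  have hab' := sub_ne_zero.2 hab
  have hac' := sub_ne_zero.2 hac
  have e1 : a + (a - b) * (a - c) / (X - a) - a = (a - b) * (a - c) / (X - a) := by ring
  have e2 : a + (a - b) * (a - c) / (X - a) - b = (a - b) * (X - c) / (X - a) := by
    field_simp; ring
  have e3 : a + (a - b) * (a - c) / (X - a) - c = (a - c) * (X - b) / (X - a) := by
    field_simp; ring
  have hV' : (V * (a - b) * (a - c) / (X - a) ^ 2) ^ 2 = (a + (a - b) * (a - c) / (X - a) - a) *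
      (a + (a - b) * (a - c) / (X - a) - b) * (a + (a - b) * (a - c) / (X - a) - c) := by
    rw [e1, e2, e3]
    field_simp
    linear_combination h
  have hV0 : V * (a - b) * (a - c) / (X - a) ^ 2 ≠ 0 := by positivity
  refine ⟨_, V * (a - b) * (a - c) / (X - a) ^ 2, hV0, hV', ?_, rfl⟩
  rw [← sub_left_inj (a := a), dup_sub (by rw [← hV']; exact pow_ne_zero 2 hV0), dup_sub h0, e1, e2,
    e3]
  field_simp
  ring

/-- A point all of whose `X - e` are squares is a double. -/
theorem exists_half [CharZero F] {a b c X r s t : F} (hab : a ≠ b) (hac : a ≠ c) (hbc : b ≠ c)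
    (ha : X - a = r ^ 2) (hb : X - b = s ^ 2) (hc : X - c = t ^ 2) :
    ∃ X' V' : F, V' ≠ 0 ∧ V' ^ 2 = (X' - a) * (X' - b) * (X' - c) ∧ dup a b c X' = X := by
  have h1 : r + s ≠ 0 := fun h => hab (by linear_combination hb - ha - (r - s) * h)
  have h2 : r + t ≠ 0 := fun h => hac (by linear_combination hc - ha - (r - t) * h)
  have h3 : s + t ≠ 0 := fun h => hbc (by linear_combination hc - hb - (s - t) * h)
  have e1 : X + r * s + r * t + s * t - a = (r + s) * (r + t) := by linear_combination ha
  have e2 : X + r * s + r * t + s * t - b = (r + s) * (s + t) := by linear_combination hb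
  have e3 : X + r * s + r * t + s * t - c = (r + t) * (s + t) := by linear_combination hc
  have h0 : (r + s) * (r + t) * (s + t) ≠ 0 := mul_ne_zero (mul_ne_zero h1 h2) h3
  have h4 : ((r + s) * (r + t) * (s + t)) ^ 2 = (X + r * s + r * t + s * t - a) *
      (X + r * s + r * t + s * t - b) * (X + r * s + r * t + s * t - c) := by
    rw [e1, e2, e3]; ring
  refine ⟨X + r * s + r * t + s * t, (r + s) * (r + t) * (s + t), h0, h4, ?_⟩
  rw [← sub_left_inj (a := a), dup_sub (by rw [← h4]; exact pow_ne_zero 2 h0), ha, e1, e2, e3,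
    show a - b = s ^ 2 - r ^ 2 by linear_combination hb - ha,
    show a - c = t ^ 2 - r ^ 2 by linear_combination hc - ha]
  field_simp
  ring

end TwoTorsionCurve

section SignNormalization

theorem lt_translate_hi {lo mid hi x : ℝ} (h₁ : lo < mid) (h₂ : mid < hi)
    (h : 0 < (x - hi) * (x - lo) * (x - mid)) :
    mid < hi + (hi - lo) * (hi - mid) / (x - hi) ↔ mid < x := by
  have hx : x - hi ≠ 0 := by rintro h0; simp [h0] at h
  have hn : 0 < (hi - lo) * (hi - mid) := mul_pos (by linarith) (by linarith)
  have key : hi + (hi - lo) * (hi - mid) / (x - hi) - mid = (hi - mid) * (x - lo) / (x - hi) := by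
    field_simp; ring
  rw [← sub_pos, key]
  constructor
  · intro h3
    by_contra! h4
    have h5 : x - hi < 0 := by linarith
    have h6 : (x - hi) * (x - mid) ≥ 0 := mul_nonneg_of_nonpos_of_nonpos h5.le (by linarith)
    have h7 : 0 < x - lo := by
      by_contra! h7
      nlinarith
    exact absurd h3 (not_lt.2 (div_nonpos_of_nonneg_of_nonpos
      (mul_nonneg (by linarith) h7.le) h5.le))
  · intro h3
    have h4 : 0 < (x - lo) * (x - mid) := mul_pos (by linarith) (by linarith)
    have h5 : 0 < x - hi := by
      by_contra! h5
      nlinarith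
    exact div_pos (mul_pos (by linarith) (by linarith)) h5

theorem lt_translate_mid {lo mid hi x : ℝ} (h₁ : lo < mid) (h₂ : mid < hi) (hx : x ≠ mid) :
    mid < mid + (mid - hi) * (mid - lo) / (x - mid) ↔ ¬ mid < x := by
  have hn : (mid - hi) * (mid - lo) < 0 := mul_neg_of_neg_of_pos (by linarith) (by linarith)
  rw [lt_add_iff_pos_right]
  rcases hx.lt_or_gt with h | h
  · exact iff_of_true (div_pos_of_neg_of_neg hn (by linarith)) h.not_gt
  · exact iff_of_false (div_neg_of_neg_of_pos hn (by linarith)).not_gt (not_not.2 h)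

theorem lt_translate_lo {lo mid hi x : ℝ} (h₁ : lo < mid) (h₂ : mid < hi)
    (h : 0 < (x - lo) * (x - mid) * (x - hi)) :
    mid < lo + (lo - mid) * (lo - hi) / (x - lo) ↔ ¬ mid < x := by
  have hx : 0 < x - lo := by
    by_contra! h3
    have : 0 < (x - mid) * (x - hi) := mul_pos_of_neg_of_neg (by linarith) (by linarith)
    nlinarith
  have h' : 0 < (x - mid) * (x - hi) := by
    by_contra! h3
    nlinarith
  have key : lo + (lo - mid) * (lo - hi) / (x - lo) - mid = (mid - lo) * (hi - x) / (x - lo) := by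
    field_simp; ring
  rw [← sub_pos, key, div_pos_iff_of_pos_right hx, mul_pos_iff_of_pos_left (by linarith)]
  constructor
  · intro h3 h4
    nlinarith
  · intro h3
    linarith

variable {L : Type*} [Field L]

/-- A root of the cubic defining the elliptic curve. -/
def rootA (η : L) : L := 5 + 5 * η - 3 * η ^ 2

/-- A root of the cubic defining the elliptic curve. -/
def rootB (η : L) : L := 9 - 7 * η ^ 2

/-- A root of the cubic defining the elliptic curve. -/
def rootC (η : L) : L := 2 * η ^ 2 - 4 * η

/-- `(X, V)` is a point of order greater than two on the elliptic curve. -/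
def OnCurve (η X V : L) : Prop :=
  V ≠ 0 ∧ V ^ 2 = (X - rootA η) * (X - rootB η) * (X - rootC η)

/-- Duplication on the elliptic curve. -/
def dbl (η X : L) : L := dup (rootA η) (rootB η) (rootC η) X

variable {η : L}

theorem RealPlaces.map_root (τ : L →+* ℝ) : τ (rootA η) = 5 + 5 * τ η - 3 * τ η ^ 2 ∧
    τ (rootB η) = 9 - 7 * τ η ^ 2 ∧ τ (rootC η) = 2 * τ η ^ 2 - 4 * τ η := by
  simp [rootA, rootB, rootC, map_ofNat τ]

theorem RealPlaces.order₀ (P : RealPlaces η) :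
    P.σ 0 (rootB η) < P.σ 0 (rootC η) ∧ P.σ 0 (rootC η) < P.σ 0 (rootA η) := by
  obtain ⟨ha, hb, hc⟩ := map_root (η := η) (P.σ 0)
  have := P.lower₀
  have := P.upper₀
  rw [ha, hb, hc]
  constructor <;> nlinarith

theorem RealPlaces.order₁ (P : RealPlaces η) :
    P.σ 1 (rootC η) < P.σ 1 (rootA η) ∧ P.σ 1 (rootA η) < P.σ 1 (rootB η) := by
  obtain ⟨ha, hb, hc⟩ := map_root (η := η) (P.σ 1)
  have := P.lower₁
  have := P.upper₁
  rw [ha, hb, hc]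
  constructor <;> nlinarith

theorem RealPlaces.order₂ (P : RealPlaces η) :
    P.σ 2 (rootA η) < P.σ 2 (rootB η) ∧ P.σ 2 (rootB η) < P.σ 2 (rootC η) := by
  obtain ⟨ha, hb, hc⟩ := map_root (η := η) (P.σ 2)
  have := P.lower₂
  have := P.upper₂
  rw [ha, hb, hc]
  constructor <;> nlinarith

theorem RealPlaces.root_ne (P : RealPlaces η) :
    rootA η ≠ rootB η ∧ rootA η ≠ rootC η ∧ rootB η ≠ rootC η := by
  have h := P.order₀
  refine ⟨fun e => ?_, fun e => ?_, fun e => ?_⟩ <;> rw [e] at h <;> linarith [h.1, h.2]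

/-- The `i`-th real image of the point lies on the identity component. -/
def RealPlaces.InIdentity (P : RealPlaces η) (X : L) : Fin 3 → Prop :=
  ![P.σ 0 (rootC η) < P.σ 0 X, P.σ 1 (rootA η) < P.σ 1 X, P.σ 2 (rootB η) < P.σ 2 X]

theorem OnCurve.pos {X V : L} (h : OnCurve η X V) (τ : L →+* ℝ) :
    0 < (τ X - τ (rootA η)) * (τ X - τ (rootB η)) * (τ X - τ (rootC η)) := by
  rw [← map_sub, ← map_sub, ← map_sub, ← map_mul, ← map_mul, ← h.2, map_pow]
  have : τ V ≠ 0 := by simpa using h.1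
  positivity

/-- Up to translation by a point of order two, the real images of a point all lie on the identity
component, or none of them does. -/
theorem OnCurve.exists_inIdentity [CharZero L] (P : RealPlaces η) {X V : L} (h : OnCurve η X V) :
    ∃ X' V', OnCurve η X' V' ∧ dbl η X' = dbl η X ∧
      ((∀ i, P.InIdentity X' i) ∨ ∀ i, ¬ P.InIdentity X' i) := by
  obtain ⟨hab, hac, hbc⟩ := P.root_ne
  have p0 := h.pos (P.σ 0)
  have p1 := h.pos (P.σ 1)
  have p2 := h.pos (P.σ 2)
  have hA : ∃ X' V', OnCurve η X' V' ∧ dbl η X' = dbl η X ∧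
      (P.InIdentity X' 0 ↔ P.InIdentity X 0) ∧ (P.InIdentity X' 1 ↔ ¬ P.InIdentity X 1) ∧
      (P.InIdentity X' 2 ↔ ¬ P.InIdentity X 2) := by
    obtain ⟨X', V', h0, h1, h2, rfl⟩ := exists_translate hab hac h.1 h.2
    refine ⟨_, V', ⟨h0, h1⟩, h2, ?_, ?_, ?_⟩ <;>
      simp only [RealPlaces.InIdentity, Matrix.cons_val, map_add, map_sub, map_mul, map_div₀]
    · exact lt_translate_hi P.order₀.1 P.order₀.2 p0
    · exact lt_translate_mid P.order₁.1 P.order₁.2 (by rintro e; simp [e] at p1)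
    · exact lt_translate_lo P.order₂.1 P.order₂.2 p2
  have hB : ∃ X' V', OnCurve η X' V' ∧ dbl η X' = dbl η X ∧
      (P.InIdentity X' 0 ↔ ¬ P.InIdentity X 0) ∧ (P.InIdentity X' 1 ↔ P.InIdentity X 1) ∧
      (P.InIdentity X' 2 ↔ ¬ P.InIdentity X 2) := by
    obtain ⟨X', V', h0, h1, h2, rfl⟩ := exists_translate hbc hab.symm h.1
      (h.2.trans (by ring : _ = (X - rootB η) * (X - rootC η) * (X - rootA η)))
    rw [dup_rotate (rootA η), dup_rotate (rootA η)] at h2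
    refine ⟨_, V', ⟨h0, h1.trans (by ring)⟩, h2, ?_, ?_, ?_⟩ <;>
      simp only [RealPlaces.InIdentity, Matrix.cons_val, map_add, map_sub, map_mul, map_div₀]
    · exact lt_translate_lo P.order₀.1 P.order₀.2 (by convert p0 using 1; ring)
    · exact lt_translate_hi P.order₁.1 P.order₁.2 (by convert p1 using 1; ring)
    · exact lt_translate_mid P.order₂.1 P.order₂.2 (by rintro e; simp [e] at p2)
  have hC : ∃ X' V', OnCurve η X' V' ∧ dbl η X' = dbl η X ∧
      (P.InIdentity X' 0 ↔ ¬ P.InIdentity X 0) ∧ (P.InIdentity X' 1 ↔ ¬ P.InIdentity X 1) ∧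
      (P.InIdentity X' 2 ↔ P.InIdentity X 2) := by
    obtain ⟨X', V', h0, h1, h2, rfl⟩ := exists_translate hac.symm hbc.symm h.1
      (h.2.trans (by ring : _ = (X - rootC η) * (X - rootA η) * (X - rootB η)))
    rw [← dup_rotate (rootC η), ← dup_rotate (rootC η)] at h2
    refine ⟨_, V', ⟨h0, h1.trans (by ring)⟩, h2, ?_, ?_, ?_⟩ <;>
      simp only [RealPlaces.InIdentity, Matrix.cons_val, map_add, map_sub, map_mul, map_div₀]
    · exact lt_translate_mid P.order₀.1 P.order₀.2 (by rintro e; simp [e] at p0)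
    · exact lt_translate_lo P.order₁.1 P.order₁.2 (by convert p1 using 1; ring)
    · exact lt_translate_hi P.order₂.1 P.order₂.2 (by convert p2 using 1; ring)
  simp only [Fin.forall_fin_succ, Fin.succ_zero_eq_one, Fin.succ_one_eq_two, IsEmpty.forall_iff,
    and_true]
  by_cases b0 : P.InIdentity X 0 <;> by_cases b1 : P.InIdentity X 1 <;>
    by_cases b2 : P.InIdentity X 2
  · exact ⟨X, V, h, rfl, by simp [b0, b1, b2]⟩
  · obtain ⟨X', V', h', e, i⟩ := hC; exact ⟨X', V', h', e, by simp [i.1, i.2.1, i.2.2, b0, b1, b2]⟩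
  · obtain ⟨X', V', h', e, i⟩ := hB; exact ⟨X', V', h', e, by simp [i.1, i.2.1, i.2.2, b0, b1, b2]⟩
  · obtain ⟨X', V', h', e, i⟩ := hA; exact ⟨X', V', h', e, by simp [i.1, i.2.1, i.2.2, b0, b1, b2]⟩
  · obtain ⟨X', V', h', e, i⟩ := hA; exact ⟨X', V', h', e, by simp [i.1, i.2.1, i.2.2, b0, b1, b2]⟩
  · obtain ⟨X', V', h', e, i⟩ := hB; exact ⟨X', V', h', e, by simp [i.1, i.2.1, i.2.2, b0, b1, b2]⟩
  · obtain ⟨X', V', h', e, i⟩ := hC; exact ⟨X', V', h', e, by simp [i.1, i.2.1, i.2.2, b0, b1, b2]⟩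
  · exact ⟨X, V, h, rfl, by simp [b0, b1, b2]⟩

/-- If `z` is a unit times a square, then a unit with the same signs as `z` is `z` up to
squares. -/
theorem exists_eq_mul_sq_of_signs [NumberField L] (h3 : Module.finrank ℚ L = 3)
    (hη : η ^ 3 + η ^ 2 - 2 * η - 1 = 0) (P : RealPlaces η) {z r : L} {u ε : (𝓞 L)ˣ}
    (h : z = u * r ^ 2) (hε : ∀ i, 0 < P.σ i ε * P.σ i z) : ∃ s : L, z = ε * s ^ 2 := by
  obtain ⟨w, hw⟩ := unit_eq_sq_of_totallyPositive h3 hη P (u * ε) fun i => by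
    have h1 := hε i
    have h2 : P.σ i r ≠ 0 := by
      intro h2
      simp [h, h2] at h1
    have h4 : 0 < P.σ i r ^ 2 := by positivity
    rw [h, map_mul, map_pow] at h1
    rw [Units.val_mul, map_mul, map_mul]
    nlinarith
  refine ⟨w / ε * r, ?_⟩
  have hsq : (u : L) * ε = (w : L) ^ 2 := by exact_mod_cast congrArg (fun t : (𝓞 L)ˣ => (t : L)) hw
  have hε0 : (ε : L) ≠ 0 := by simp
  rw [h]
  field_simp
  linear_combination r ^ 2 * hsq

/-- The differences of the roots are units. -/
theorem exists_units_root_sub (hη : η ^ 3 + η ^ 2 - 2 * η - 1 = 0) : ∃ u v w : (𝓞 L)ˣ,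
    (u : L) = rootA η - rootB η ∧ (v : L) = rootB η - rootC η ∧ (w : L) = rootC η - rootA η := by
  have hi := isIntegral_of_cubic hη
  have hu := exists_unit_coe_eq (isIntegral_int_coords hi (-4) 5 4)
    (isIntegral_int_coords hi 6 9 (-11)) (by push_cast; linear_combination (-44 * η + 25) * hη)
  have hv := exists_unit_coe_eq (isIntegral_int_coords hi 9 4 (-9))
    (isIntegral_int_coords hi (-23) (-65) (-29))
    (by push_cast; linear_combination (261 * η + 208) * hη)
  have hw := exists_unit_coe_eq (isIntegral_int_coords hi (-5) (-9) 5)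
    (isIntegral_int_coords hi (-227) 56 101)
    (by push_cast; linear_combination (505 * η - 1134) * hη)
  obtain ⟨u, hu⟩ := hu
  obtain ⟨v, hv⟩ := hv
  obtain ⟨w, hw⟩ := hw
  refine ⟨u, v, w, ?_, ?_, ?_⟩
  · rw [hu, rootA, rootB]; push_cast; ring
  · rw [hv, rootB, rootC]; push_cast; ring
  · rw [hw, rootC, rootA]; push_cast; ring

theorem OnCurve.exists_unit_mul_sq [NumberField L] [IsPrincipalIdealRing (𝓞 L)]
    (hη : η ^ 3 + η ^ 2 - 2 * η - 1 = 0) {X V : L} (h : OnCurve η X V) :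
    (∃ (u : (𝓞 L)ˣ) (r : L), X - rootA η = u * r ^ 2) ∧
    (∃ (u : (𝓞 L)ˣ) (r : L), X - rootB η = u * r ^ 2) ∧
    (∃ (u : (𝓞 L)ˣ) (r : L), X - rootC η = u * r ^ 2) := by
  have hi := isIntegral_of_cubic hη
  obtain ⟨a, ha⟩ : ∃ a : 𝓞 L, algebraMap (𝓞 L) L a = rootA η :=
    ⟨⟨_, isIntegral_int_coords hi 5 5 (-3)⟩, by rw [rootA]; simp; ring⟩
  obtain ⟨b, hb⟩ : ∃ a : 𝓞 L, algebraMap (𝓞 L) L a = rootB η :=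
    ⟨⟨_, isIntegral_int_coords hi 9 0 (-7)⟩, by rw [rootB]; simp; ring⟩
  obtain ⟨c, hc⟩ : ∃ a : 𝓞 L, algebraMap (𝓞 L) L a = rootC η :=
    ⟨⟨_, isIntegral_int_coords hi 0 (-4) 2⟩, by rw [rootC]; simp; ring⟩
  obtain ⟨u, v, w, hu, hv, hw⟩ := exists_units_root_sub hη
  have hab : IsUnit (a - b) := ⟨u, FaithfulSMul.algebraMap_injective (𝓞 L) L (by
    rw [hu, map_sub, ha, hb])⟩
  have hbc : IsUnit (b - c) := ⟨v, FaithfulSMul.algebraMap_injective (𝓞 L) L (by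
    rw [hv, map_sub, hb, hc])⟩
  have hca : IsUnit (c - a) := ⟨w, FaithfulSMul.algebraMap_injective (𝓞 L) L (by
    rw [hw, map_sub, hc, ha])⟩
  have h2 := h.2
  rw [← ha, ← hb, ← hc] at h2 ⊢
  have hba : IsUnit (b - a) := by rw [← neg_sub]; exact hab.neg
  have hcb : IsUnit (c - b) := by rw [← neg_sub]; exact hbc.neg
  have hac : IsUnit (a - c) := by rw [← neg_sub]; exact hca.neg
  exact ⟨exists_unit_mul_sq_of_sq_eq hba hca h2,
    exists_unit_mul_sq_of_sq_eq (c := a) hcb hab (h2.trans (by ring)),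
    exists_unit_mul_sq_of_sq_eq (c := b) hac hbc (h2.trans (by ring))⟩

theorem lt_hi_of_mid_lt {lo mid hi x : ℝ} (h₁ : lo < mid)
    (h : 0 < (x - lo) * (x - mid) * (x - hi)) (hx : mid < x) : hi < x := by
  have : 0 < (x - lo) * (x - mid) := mul_pos (by linarith) (by linarith)
  linarith [(mul_pos_iff_of_pos_left this).1 h]

theorem lo_lt_of_not_mid_lt {lo mid hi x : ℝ} (h₂ : mid < hi)
    (h : 0 < (x - lo) * (x - mid) * (x - hi)) (hx : ¬ mid < x) : lo < x ∧ x < mid := by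
  have hne : x ≠ mid := by rintro rfl; simp at h
  have hlt : x < mid := lt_of_le_of_ne (not_lt.1 hx) hne
  have : 0 < (x - mid) * (x - hi) := mul_pos_of_neg_of_neg (by linarith) (by linarith)
  rw [mul_assoc] at h
  exact ⟨by linarith [(mul_pos_iff_of_pos_right this).1 h], hlt⟩

/-- The outcome of a two-descent: up to translation by a point of order two, a point lies in one
of two explicit classes. -/
theorem OnCurve.exists_twoDescent [NumberField L] [IsPrincipalIdealRing (𝓞 L)]
    (h3 : Module.finrank ℚ L = 3) (hη : η ^ 3 + η ^ 2 - 2 * η - 1 = 0) (P : RealPlaces η)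
    {X V : L} (h : OnCurve η X V) : ∃ X' V', OnCurve η X' V' ∧ dbl η X' = dbl η X ∧
      ((∃ r s t, X' - rootA η = r ^ 2 ∧ X' - rootB η = s ^ 2 ∧ X' - rootC η = t ^ 2) ∨
      (∃ r s t, X' - rootA η = (rootC η - rootA η) * r ^ 2 ∧
        X' - rootB η = (rootA η - rootB η) * s ^ 2 ∧
        X' - rootC η = (rootB η - rootC η) * t ^ 2)) := by
  obtain ⟨X', V', h', e, hI⟩ := h.exists_inIdentity P
  refine ⟨X', V', h', e, ?_⟩
  obtain ⟨⟨u₁, r₁, e₁⟩, ⟨u₂, r₂, e₂⟩, ⟨u₃, r₃, e₃⟩⟩ := h'.exists_unit_mul_sq hη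
  obtain ⟨u, v, w, hu, hv, hw⟩ := exists_units_root_sub hη
  have p0 : 0 < (P.σ 0 X' - P.σ 0 (rootB η)) * (P.σ 0 X' - P.σ 0 (rootC η)) *
      (P.σ 0 X' - P.σ 0 (rootA η)) := by convert h'.pos (P.σ 0) using 1; ring
  have p1 : 0 < (P.σ 1 X' - P.σ 1 (rootC η)) * (P.σ 1 X' - P.σ 1 (rootA η)) *
      (P.σ 1 X' - P.σ 1 (rootB η)) := by convert h'.pos (P.σ 1) using 1; ring
  have p2 := h'.pos (P.σ 2)
  obtain ⟨o0, o0'⟩ := P.order₀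
  obtain ⟨o1, o1'⟩ := P.order₁
  obtain ⟨o2, o2'⟩ := P.order₂
  simp only [Fin.forall_fin_succ, Fin.succ_zero_eq_one, Fin.succ_one_eq_two, IsEmpty.forall_iff,
    and_true, RealPlaces.InIdentity, Matrix.cons_val] at hI
  rcases hI with ⟨i0, i1, i2⟩ | ⟨i0, i1, i2⟩
  · left
    have j0 := lt_hi_of_mid_lt o0 p0 i0
    have j1 := lt_hi_of_mid_lt o1 p1 i1
    have j2 := lt_hi_of_mid_lt o2 p2 i2
    obtain ⟨r, hr⟩ := exists_eq_mul_sq_of_signs h3 hη P (ε := 1) e₁ (by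
      simp only [Fin.forall_fin_succ, Fin.succ_zero_eq_one, Fin.succ_one_eq_two]
      simp; refine ⟨?_, ?_, ?_⟩ <;> linarith)
    obtain ⟨s, hs⟩ := exists_eq_mul_sq_of_signs h3 hη P (ε := 1) e₂ (by
      simp only [Fin.forall_fin_succ, Fin.succ_zero_eq_one, Fin.succ_one_eq_two]
      simp; refine ⟨?_, ?_, ?_⟩ <;> linarith)
    obtain ⟨t, ht⟩ := exists_eq_mul_sq_of_signs h3 hη P (ε := 1) e₃ (by
      simp only [Fin.forall_fin_succ, Fin.succ_zero_eq_one, Fin.succ_one_eq_two]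
      simp; refine ⟨?_, ?_, ?_⟩ <;> linarith)
    exact ⟨r, s, t, by simpa using hr, by simpa using hs, by simpa using ht⟩
  · right
    have j0 := lo_lt_of_not_mid_lt o0' p0 i0
    have j1 := lo_lt_of_not_mid_lt o1' p1 i1
    have j2 := lo_lt_of_not_mid_lt o2' p2 i2
    obtain ⟨r, hr⟩ := exists_eq_mul_sq_of_signs h3 hη P (ε := w) e₁ (by
      simp only [Fin.forall_fin_succ, Fin.succ_zero_eq_one, Fin.succ_one_eq_two, hw, map_sub,
        IsEmpty.forall_iff, and_true]
      refine ⟨?_, ?_, ?_⟩ <;> nlinarith)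
    obtain ⟨s, hs⟩ := exists_eq_mul_sq_of_signs h3 hη P (ε := u) e₂ (by
      simp only [Fin.forall_fin_succ, Fin.succ_zero_eq_one, Fin.succ_one_eq_two, hu, map_sub,
        IsEmpty.forall_iff, and_true]
      refine ⟨?_, ?_, ?_⟩ <;> nlinarith)
    obtain ⟨t, ht⟩ := exists_eq_mul_sq_of_signs h3 hη P (ε := v) e₃ (by
      simp only [Fin.forall_fin_succ, Fin.succ_zero_eq_one, Fin.succ_one_eq_two, hv, map_sub,
        IsEmpty.forall_iff, and_true]
      refine ⟨?_, ?_, ?_⟩ <;> nlinarith)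
    exact ⟨r, s, t, by rw [hr, hw], by rw [hs, hu], by rw [ht, hv]⟩

end SignNormalization

section TwoAdic

/-- Triples of integers, thought of as the coordinates of an algebraic integer with respect
to the basis `1, η, η ^ 2`, where `η ^ 3 + η ^ 2 - 2 * η - 1 = 0`. -/
@[ext]
structure Cub where
  /-- the coefficient of `1` -/
  a : ℤ
  /-- the coefficient of `η` -/
  b : ℤ
  /-- the coefficient of `η ^ 2` -/
  c : ℤ

namespace Cub

instance : Add Cub := ⟨fun x y => ⟨x.a + y.a, x.b + y.b, x.c + y.c⟩⟩

instance : Sub Cub := ⟨fun x y => ⟨x.a - y.a, x.b - y.b, x.c - y.c⟩⟩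

instance : Mul Cub := ⟨fun x y =>
  ⟨x.a * y.a + (x.b * y.c + x.c * y.b) - x.c * y.c,
    x.a * y.b + x.b * y.a + 2 * (x.b * y.c + x.c * y.b) - x.c * y.c,
    x.a * y.c + x.b * y.b + x.c * y.a - (x.b * y.c + x.c * y.b) + 3 * (x.c * y.c)⟩⟩

/-- All coordinates are divisible by `n`. -/
def DvdBy (n : ℤ) (x : Cub) : Prop := n ∣ x.a ∧ n ∣ x.b ∧ n ∣ x.c

instance (n : ℤ) (x : Cub) : Decidable (x.DvdBy n) := by unfold DvdBy; infer_instance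

/-- The triple with coordinates `0` or `1`. -/
def ofBits (i j k : Bool) : Cub := ⟨i.toInt, j.toInt, k.toInt⟩

variable {L : Type*} [Field L]

/-- The element with the given coordinates. -/
def ev (η : L) (x : Cub) : L := x.a + x.b * η + x.c * η ^ 2

theorem ev_add (η : L) (x y : Cub) : ev η (x + y) = ev η x + ev η y := by
  change ((x.a + y.a : ℤ) : L) + (x.b + y.b : ℤ) * η + (x.c + y.c : ℤ) * η ^ 2 = _
  simp only [ev]; push_cast; ring

theorem ev_sub (η : L) (x y : Cub) : ev η (x - y) = ev η x - ev η y := by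
  change ((x.a - y.a : ℤ) : L) + (x.b - y.b : ℤ) * η + (x.c - y.c : ℤ) * η ^ 2 = _
  simp only [ev]; push_cast; ring

theorem ev_mul {η : L} (hη : η ^ 3 + η ^ 2 - 2 * η - 1 = 0) (x y : Cub) :
    ev η (x * y) = ev η x * ev η y := by
  change ((x.a * y.a + (x.b * y.c + x.c * y.b) - x.c * y.c : ℤ) : L) +
    (x.a * y.b + x.b * y.a + 2 * (x.b * y.c + x.c * y.b) - x.c * y.c : ℤ) * η +
    (x.a * y.c + x.b * y.b + x.c * y.a - (x.b * y.c + x.c * y.b) + 3 * (x.c * y.c) : ℤ) * η ^ 2 = _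
  simp only [ev]; push_cast
  linear_combination (-(x.b * y.c + x.c * y.b) - x.c * y.c * (η - 1) : L) * hη

end Cub

open Cub

variable {L : Type*} [Field L]

/-- `1, η, η ^ 2` is an integral basis, and `η` is a root of `X ^ 3 + X ^ 2 - 2 * X - 1`. -/
structure IsIntegralCubicBasis (η : L) : Prop where
  relation : η ^ 3 + η ^ 2 - 2 * η - 1 = 0
  unique : ∀ i j k : ℚ, (i : L) + j * η + k * η ^ 2 = 0 → i = 0 ∧ j = 0 ∧ k = 0
  exists_coords : ∀ z : L, IsIntegral ℤ z → ∃ x : Cub, z = ev η x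

theorem isIntegralCubicBasis_gen_add_two [NumberField L] (B : PowerBasis ℚ L)
    (hB : minpoly ℤ B.gen = septicPoly) : IsIntegralCubicBasis (B.gen + 2) where
  relation := by linear_combination gen_relation B hB
  unique i j k h := by
    obtain ⟨h1, h2, h3⟩ := coords_unique B hB (i := i + 2 * j + 4 * k) (j := j + 4 * k) (k := k)
      (by push_cast; linear_combination h)
    subst h3
    constructor <;> [linarith; constructor <;> linarith]
  exists_coords z hz := by
    obtain ⟨i, j, k, rfl⟩ := exists_int_coords_gen B hB hz
    exact ⟨⟨i - 2 * j + 4 * k, j - 4 * k, k⟩, by simp only [ev]; push_cast; ring⟩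

/-- A subring of the cubic field in which reduction modulo `2` can be read off from
coordinates. -/
structure TwoIntegral (η : L) (O : Subring L) : Prop where
  gen_mem : η ∈ O
  exists_bits : ∀ z ∈ O, ∃ i j k, ∃ z' ∈ O, z = ev η (ofBits i j k) + 2 * z'
  dvdBy_two : ∀ x, ∀ z ∈ O, ev η x = 2 * z → DvdBy 2 x

theorem TwoIntegral.ev_mem {η : L} {O : Subring L} (h : TwoIntegral η O) (x : Cub) :
    ev η x ∈ O :=
  add_mem (add_mem (intCast_mem _ _) (mul_mem (intCast_mem _ _) h.gen_mem))
    (mul_mem (intCast_mem _ _) (pow_mem h.gen_mem 2))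

theorem TwoIntegral.dvdBy_four [CharZero L] {η : L} {O : Subring L} (h : TwoIntegral η O) {x : Cub}
    {z : L} (hz : z ∈ O) (e : ev η x = 4 * z) : DvdBy 4 x := by
  obtain ⟨⟨p, hp⟩, ⟨q, hq⟩, ⟨r, hr⟩⟩ := h.dvdBy_two x (2 * z)
    (mul_mem (ofNat_mem _ 2) hz) (by rw [e]; ring)
  obtain ⟨⟨p', rfl⟩, ⟨q', rfl⟩, ⟨r', rfl⟩⟩ := h.dvdBy_two ⟨p, q, r⟩ z hz (by
    simp only [ev, hp, hq, hr] at e ⊢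
    push_cast at e
    linear_combination e / 2)
  exact ⟨⟨p', by rw [hp]; ring⟩, ⟨q', by rw [hq]; ring⟩, ⟨r', by rw [hr]; ring⟩⟩

theorem exists_ev_ofBits (η : L) (x : Cub) :
    ∃ i j k y, ev η x = ev η (ofBits i j k) + 2 * ev η y := by
  have key (n : ℤ) : ∃ (i : Bool) (m : ℤ), n = i.toInt + 2 * m := by
    rcases Int.even_or_odd' n with ⟨m, rfl | rfl⟩
    · exact ⟨false, m, by simp⟩
    · exact ⟨true, m, by simp [add_comm]⟩
  obtain ⟨i, p, hp⟩ := key x.a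
  obtain ⟨j, q, hq⟩ := key x.b
  obtain ⟨k, r, hr⟩ := key x.c
  refine ⟨i, j, k, ⟨p, q, r⟩, ?_⟩
  simp only [ev, ofBits, hp, hq, hr]
  push_cast; ring

theorem ev_ofBits_false (η : L) : ev η (ofBits false false false) = 0 := by
  simp [ev, ofBits]

variable [NumberField L] {η : L}

theorem IsIntegralCubicBasis.twoIntegral (h : IsIntegralCubicBasis η) :
    TwoIntegral η (algebraMap (𝓞 L) L).range where
  gen_mem := ⟨⟨η, isIntegral_of_cubic h.relation⟩, rfl⟩
  exists_bits := by
    rintro _ ⟨z, rfl⟩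
    obtain ⟨x, hx⟩ := h.exists_coords z z.isIntegral_coe
    obtain ⟨i, j, k, y, e⟩ := exists_ev_ofBits η x
    refine ⟨i, j, k, ev η y, ⟨⟨_, ?_⟩, rfl⟩, hx.trans e⟩
    exact isIntegral_int_coords (isIntegral_of_cubic h.relation) y.a y.b y.c
  dvdBy_two := by
    rintro x _ ⟨z, rfl⟩ e
    obtain ⟨y, hy⟩ := h.exists_coords z z.isIntegral_coe
    change _ = 2 * (z : L) at e
    rw [hy] at e
    simp only [ev] at e
    obtain ⟨h1, h2, h3⟩ := h.unique (x.a - 2 * y.a) (x.b - 2 * y.b) (x.c - 2 * y.c)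
      (by push_cast; linear_combination e)
    exact ⟨⟨y.a, by exact_mod_cast sub_eq_zero.1 h1⟩, ⟨y.b, by exact_mod_cast sub_eq_zero.1 h2⟩,
      ⟨y.c, by exact_mod_cast sub_eq_zero.1 h3⟩⟩

theorem ofBits_eq_zero_of_dvdBy_two : ∀ i j k i' j' k', DvdBy 2 (ofBits i j k * ofBits i' j' k') →
    (i = false ∧ j = false ∧ k = false) ∨ (i' = false ∧ j' = false ∧ k' = false) := by
  decide +kernel

theorem IsIntegralCubicBasis.prime_two (h : IsIntegralCubicBasis η) : Prime (2 : 𝓞 L) := by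
  have hO := h.twoIntegral
  have hdvd {x z : 𝓞 L} (e : (x : L) = 2 * z) : 2 ∣ x :=
    ⟨z, RingOfIntegers.ext (by simpa [map_ofNat (algebraMap (𝓞 L) L) 2] using e)⟩
  refine ⟨two_ne_zero, fun hu => ?_, fun x y hxy => ?_⟩
  · obtain ⟨z, hz⟩ := hu.dvd (a := 1)
    have := hO.dvdBy_two ⟨1, 0, 0⟩ z ⟨z, rfl⟩ (by
      have := congrArg (algebraMap (𝓞 L) L) hz
      simpa [ev, map_ofNat (algebraMap (𝓞 L) L) 2] using this)
    exact absurd this (by decide)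
  · obtain ⟨z, hz⟩ := hxy
    obtain ⟨i, j, k, _, ⟨x', rfl⟩, hx⟩ := hO.exists_bits x ⟨x, rfl⟩
    obtain ⟨i', j', k', _, ⟨y', rfl⟩, hy⟩ := hO.exists_bits y ⟨y, rfl⟩
    have e : (x : L) * y = 2 * z := by
      have := congrArg (algebraMap (𝓞 L) L) hz
      simpa [map_ofNat (algebraMap (𝓞 L) L) 2] using this
    have := ofBits_eq_zero_of_dvdBy_two i j k i' j' k' (hO.dvdBy_two _
      (z - x' * y - ev η (ofBits i j k) * y')
      (sub_mem (sub_mem ⟨z, rfl⟩ (mul_mem ⟨x', rfl⟩ ⟨y, rfl⟩))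
        (mul_mem (hO.ev_mem _) ⟨y', rfl⟩)) (by
        rw [ev_mul h.relation]
        linear_combination e - y * hx - ev η (ofBits i j k) * hy))
    rcases this with ⟨rfl, rfl, rfl⟩ | ⟨rfl, rfl, rfl⟩
    · exact .inl (hdvd (z := x') (by rw [hx, ev_ofBits_false, zero_add]))
    · exact .inr (hdvd (z := y') (by rw [hy, ev_ofBits_false, zero_add]))

open WithZero

/-- `v` is the `2`-adic valuation of the cubic field. -/
structure IsTwoAdic (η : L) (v : Valuation L ℤᵐ⁰) : Prop where
  map_two : v 2 = exp (-1 : ℤ)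
  twoIntegral : TwoIntegral η v.integer

theorem exists_eq_two_mul_of_lt_one {v : Valuation L ℤᵐ⁰} (h2 : v 2 = exp (-1 : ℤ)) {z : L}
    (hz : v z < 1) : ∃ z' ∈ v.integer, z = 2 * z' := by
  have h0 : (2 : L) ≠ 0 := two_ne_zero
  refine ⟨z / 2, ?_, by field_simp⟩
  rw [Valuation.mem_integer_iff, map_div₀, h2, div_le_iff₀ exp_pos,
    ← lt_mul_exp_iff_le (mul_ne_zero one_ne_zero exp_ne_zero)]
  rwa [one_mul, ← exp_add, neg_add_cancel, exp_zero]

theorem IsIntegralCubicBasis.exists_isTwoAdic (h : IsIntegralCubicBasis η) :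
    ∃ v : Valuation L ℤᵐ⁰, IsTwoAdic η v := by
  have hp := h.prime_two
  let w : IsDedekindDomain.HeightOneSpectrum (𝓞 L) :=
    ⟨Ideal.span {2}, (Ideal.span_singleton_prime two_ne_zero).2 hp, by simp⟩
  have h2 : w.valuation L 2 = exp (-1 : ℤ) := by
    have := w.valuation_of_algebraMap (K := L) 2
    rw [w.intValuation_singleton two_ne_zero rfl] at this
    simpa [map_ofNat (algebraMap (𝓞 L) L) 2] using this
  have hO := h.twoIntegral
  have hmem (z : 𝓞 L) : (z : L) ∈ (w.valuation L).integer := w.valuation_le_one z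
  refine ⟨w.valuation L, h2, ?_, ?_, ?_⟩
  · exact hmem ⟨η, isIntegral_of_cubic h.relation⟩
  · intro z hz
    obtain ⟨a, ha⟩ := w.exists_valuation_sub_lt_of_integer hz 1
    obtain ⟨z', hz', e⟩ := exists_eq_two_mul_of_lt_one h2 (by simpa using ha)
    obtain ⟨i, j, k, _, ⟨a', rfl⟩, ha'⟩ := hO.exists_bits a ⟨a, rfl⟩
    refine ⟨i, j, k, a' - z', sub_mem (hmem a') hz', ?_⟩
    linear_combination ha' - e
  · intro x z hz e
    obtain ⟨y, hy⟩ := hO.ev_mem x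
    have : w.valuation L y < 1 := by
      rw [show (y : L) = 2 * z from hy.trans e, map_mul, h2]
      calc exp (-1 : ℤ) * w.valuation L z ≤ exp (-1 : ℤ) * 1 := by gcongr; exact hz
        _ < 1 := by rw [mul_one, ← exp_zero, exp_lt_exp]; norm_num
    rw [w.valuation_lt_one_iff_mem] at this
    obtain ⟨t, ht⟩ := Ideal.mem_span_singleton'.1 this
    refine hO.dvdBy_two x t ⟨t, rfl⟩ ?_
    rw [← hy, ← ht, map_mul, mul_comm, map_ofNat]

end TwoAdic

section Descent

open WithZero Cub

namespace Cub

/-- The coordinates of `rootA`. -/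
def rA : Cub := ⟨5, 5, -3⟩

/-- The coordinates of `rootB`. -/
def rB : Cub := ⟨9, 0, -7⟩

/-- The coordinates of `rootC`. -/
def rC : Cub := ⟨0, -4, 2⟩

theorem not_dvdBy_four_of_pole : ∀ i j k,
    ¬ DvdBy 4 ((rA - rB) * (ofBits i j k * ofBits i j k) - (rC - rA)) := by
  decide +kernel

theorem not_dvdBy_four_of_egg : ∀ i j k i₁ j₁ k₁ i₂ j₂ k₂,
    DvdBy 4 ((rC - rA) * (ofBits i j k * ofBits i j k)
      - (rA - rB) * (ofBits i₁ j₁ k₁ * ofBits i₁ j₁ k₁) - (rB - rA)) →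
    ¬ DvdBy 4 ((rC - rA) * (ofBits i j k * ofBits i j k)
      - (rB - rC) * (ofBits i₂ j₂ k₂ * ofBits i₂ j₂ k₂) - (rC - rA)) := by
  decide +kernel

end Cub

variable {L : Type*} [Field L] {η : L}

theorem ev_rA : ev η rA = rootA η := by simp only [ev, rA, rootA]; push_cast; ring

theorem ev_rB : ev η rB = rootB η := by simp only [ev, rB, rootB]; push_cast; ring

theorem ev_rC : ev η rC = rootC η := by simp only [ev, rC, rootC]; push_cast; ring

theorem TwoIntegral.exists_sq {O : Subring L} (hη : η ^ 3 + η ^ 2 - 2 * η - 1 = 0)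
    (h : TwoIntegral η O) {z : L} (hz : z ∈ O) :
    ∃ i j k, ∃ w ∈ O, z ^ 2 = ev η (ofBits i j k * ofBits i j k) + 4 * w := by
  obtain ⟨i, j, k, z', hz', rfl⟩ := h.exists_bits z hz
  refine ⟨i, j, k, ev η (ofBits i j k) * z' + z' ^ 2,
    add_mem (mul_mem (h.ev_mem _) hz') (pow_mem hz' 2), ?_⟩
  rw [ev_mul hη]; ring

theorem TwoIntegral.map_ev_eq_one {v : Valuation L ℤᵐ⁰} (hη : η ^ 3 + η ^ 2 - 2 * η - 1 = 0)
    (h : TwoIntegral η v.integer) {x y : Cub} (hxy : x * y = ⟨1, 0, 0⟩) : v (ev η x) = 1 := by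
  have e : ev η x * ev η y = 1 := by rw [← ev_mul hη, hxy]; simp [ev]
  have hx : v (ev η x) ≤ 1 := h.ev_mem x
  have hy : v (ev η y) ≤ 1 := h.ev_mem y
  refine hx.antisymm ?_
  calc 1 = v (ev η x) * v (ev η y) := by rw [← map_mul, e, map_one]
    _ ≤ v (ev η x) * 1 := by gcongr
    _ = _ := mul_one _

theorem TwoIntegral.map_root_sub {v : Valuation L ℤᵐ⁰} (hη : η ^ 3 + η ^ 2 - 2 * η - 1 = 0)
    (h : TwoIntegral η v.integer) : v (rootA η - rootB η) = 1 ∧ v (rootB η - rootC η) = 1 ∧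
      v (rootC η - rootA η) = 1 := by
  rw [← ev_rA, ← ev_rB, ← ev_rC, ← ev_sub, ← ev_sub, ← ev_sub]
  exact ⟨h.map_ev_eq_one hη (y := ⟨6, 9, -11⟩) rfl, h.map_ev_eq_one hη (y := ⟨-23, -65, -29⟩) rfl,
    h.map_ev_eq_one hη (y := ⟨-227, 56, 101⟩) rfl⟩

theorem mem_integer_of_eq_mul_sq {v : Valuation L ℤᵐ⁰} {z ε r : L} (hε : v ε = 1) (hz : v z ≤ 1)
    (h : z = ε * r ^ 2) : r ∈ v.integer := by
  rw [h, map_mul, hε, one_mul, map_pow] at hz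
  exact (pow_le_one_iff two_ne_zero).1 hz

/-- The second class of the two-descent has no `2`-adic points. -/
theorem IsTwoAdic.not_egg [NumberField L] {v : Valuation L ℤᵐ⁰}
    (hη : η ^ 3 + η ^ 2 - 2 * η - 1 = 0) (hv : IsTwoAdic η v)
    {X r s t : L} (hA : X - rootA η = (rootC η - rootA η) * r ^ 2)
    (hB : X - rootB η = (rootA η - rootB η) * s ^ 2)
    (hC : X - rootC η = (rootB η - rootC η) * t ^ 2) : False := by
  have h := hv.twoIntegral
  obtain ⟨vab, vbc, vca⟩ := h.map_root_sub hη
  have ma : v (rootA η) ≤ 1 := by rw [← ev_rA]; exact h.ev_mem _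
  have mb : v (rootB η) ≤ 1 := by rw [← ev_rB]; exact h.ev_mem _
  have mc : v (rootC η) ≤ 1 := by rw [← ev_rC]; exact h.ev_mem _
  have mem_ab : rootA η - rootB η ∈ v.integer := vab.le
  have mem_bc : rootB η - rootC η ∈ v.integer := vbc.le
  have mem_ca : rootC η - rootA η ∈ v.integer := vca.le
  rcases le_or_gt (v X) 1 with hX | hX
  · obtain ⟨i, j, k, p, hp, er⟩ := h.exists_sq hη
      (mem_integer_of_eq_mul_sq vca (v.map_sub_le hX ma) hA)
    obtain ⟨i₁, j₁, k₁, q, hq, es⟩ := h.exists_sq hη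
      (mem_integer_of_eq_mul_sq vab (v.map_sub_le hX mb) hB)
    obtain ⟨i₂, j₂, k₂, w, hw, et⟩ := h.exists_sq hη
      (mem_integer_of_eq_mul_sq vbc (v.map_sub_le hX mc) hC)
    refine not_dvdBy_four_of_egg i j k i₁ j₁ k₁ i₂ j₂ k₂
      (h.dvdBy_four (z := (rootA η - rootB η) * q - (rootC η - rootA η) * p)
        (sub_mem (mul_mem mem_ab hq) (mul_mem mem_ca hp)) ?_)
      (h.dvdBy_four (z := (rootB η - rootC η) * w - (rootC η - rootA η) * p)
        (sub_mem (mul_mem mem_bc hw) (mul_mem mem_ca hp)) ?_)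
    · simp only [ev_sub, ev_mul hη, ev_rA, ev_rB, ev_rC] at er es et ⊢
      linear_combination hB - hA - (rootC η - rootA η) * er + (rootA η - rootB η) * es
    · simp only [ev_sub, ev_mul hη, ev_rA, ev_rB, ev_rC] at er es et ⊢
      linear_combination hC - hA - (rootC η - rootA η) * er + (rootB η - rootC η) * et
  · have vr : v r ^ 2 = v X := by
      rw [← v.map_sub_eq_of_lt_left (ma.trans_lt hX), hA, map_mul, vca, one_mul, map_pow]
    have vs : v s ^ 2 = v X := by
      rw [← v.map_sub_eq_of_lt_left (mb.trans_lt hX), hB, map_mul, vab, one_mul, map_pow]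
    have hr1 : 1 < v r := by rwa [← one_lt_pow_iff_of_nonneg zero_le two_ne_zero, vr]
    have hr0 : r ≠ 0 := by rintro rfl; simp at hr1
    have hrs : v s = v r := (pow_left_inj₀ zero_le zero_le two_ne_zero).1 (vs.trans vr.symm)
    obtain ⟨i, j, k, w, hw, es⟩ := h.exists_sq hη (z := s / r) (by
      rw [Valuation.mem_integer_iff, map_div₀, hrs, div_self (by simpa using hr0)])
    obtain ⟨t', ht', et⟩ := exists_eq_two_mul_of_lt_one hv.map_two (z := r⁻¹) (by
      rw [map_inv₀]; exact inv_lt_one_of_one_lt₀ hr1)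
    refine not_dvdBy_four_of_pole i j k
      (h.dvdBy_four (z := (rootA η - rootB η) * t' ^ 2 - (rootA η - rootB η) * w)
        (sub_mem (mul_mem mem_ab (pow_mem ht' 2)) (mul_mem mem_ab hw)) ?_)
    simp only [ev_sub, ev_mul hη, ev_rA, ev_rB, ev_rC] at es ⊢
    have e1 : (rootA η - rootB η) * (s / r) ^ 2 =
        (rootC η - rootA η) + (rootA η - rootB η) * r⁻¹ ^ 2 := by
      field_simp
      linear_combination hA - hB
    rw [et] at e1
    linear_combination e1 - (rootA η - rootB η) * es

namespace Cub

theorem eq_one_of_singular : ∀ i j k, DvdBy 2 ((ofBits i j k - rA) * (ofBits i j k - rA)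
    - (rA - rB) * (rA - rC)) → i = true ∧ j = false ∧ k = false := by
  decide +kernel

theorem bits_of_sq_eq : ∀ i j k, DvdBy 2 (ofBits i j k * ofBits i j k
    - (⟨1, 0, 0⟩ - rA) * (⟨1, 0, 0⟩ - rB) * (⟨1, 0, 0⟩ - rC)) →
    i = true ∧ j = true ∧ k = true := by
  decide +kernel

theorem not_dvdBy_two_of_singular : ∀ i j k i' j' k',
    ¬ DvdBy 2 (ofBits i j k * ofBits i j k + ⟨1, 1, 1⟩ * ofBits i j k
      - (⟨-11, -1, 8⟩ * (ofBits i' j' k' * ofBits i' j' k') + ⟨17, 8, -25⟩ * ofBits i' j' k'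
        + ⟨88, 128, -169⟩)) := by
  decide +kernel

theorem deriv_eq : (⟨1, 0, 0⟩ - rA) * (⟨1, 0, 0⟩ - rB) + (⟨1, 0, 0⟩ - rB) * (⟨1, 0, 0⟩ - rC)
    + (⟨1, 0, 0⟩ - rC) * (⟨1, 0, 0⟩ - rA) = ⟨2, 0, 0⟩ * ⟨17, 8, -25⟩ := rfl

theorem value_eq : (⟨1, 0, 0⟩ - rA) * (⟨1, 0, 0⟩ - rB) * (⟨1, 0, 0⟩ - rC)
    = ⟨1, 1, 1⟩ * ⟨1, 1, 1⟩ + ⟨4, 0, 0⟩ * ⟨88, 128, -169⟩ := rfl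

theorem sum_eq : rA + rB + rC = ⟨3, 0, 0⟩ - ⟨-11, -1, 8⟩ := rfl

end Cub

theorem ev_int (η : L) (n : ℤ) : ev η ⟨n, 0, 0⟩ = n := by simp [ev]

/-- No `2`-adically integral point reduces to the singular point modulo `2`. -/
theorem IsTwoAdic.map_tangent_eq_one [NumberField L] {v : Valuation L ℤᵐ⁰}
    (hη : η ^ 3 + η ^ 2 - 2 * η - 1 = 0) (hv : IsTwoAdic η v) {X V : L} (hX : v X ≤ 1)
    (hXV : V ^ 2 = (X - rootA η) * (X - rootB η) * (X - rootC η)) :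
    v ((X - rootA η) ^ 2 - (rootA η - rootB η) * (rootA η - rootC η)) = 1 := by
  have h := hv.twoIntegral
  have ma : rootA η ∈ v.integer := by rw [← ev_rA]; exact h.ev_mem _
  have mb : rootB η ∈ v.integer := by rw [← ev_rB]; exact h.ev_mem _
  have mc : rootC η ∈ v.integer := by rw [← ev_rC]; exact h.ev_mem _
  have mX : X ∈ v.integer := hX
  have h2 : (2 : L) ∈ v.integer := ofNat_mem _ 2
  have mV : V ∈ v.integer := by
    have : V ^ 2 ∈ v.integer := by
      rw [hXV]; exact mul_mem (mul_mem (sub_mem mX ma) (sub_mem mX mb)) (sub_mem mX mc)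
    rw [Valuation.mem_integer_iff, map_pow] at this
    exact (pow_le_one_iff two_ne_zero).1 this
  have hle : (X - rootA η) ^ 2 - (rootA η - rootB η) * (rootA η - rootC η) ∈ v.integer :=
    sub_mem (pow_mem (sub_mem mX ma) 2) (mul_mem (sub_mem ma mb) (sub_mem ma mc))
  by_contra hne
  obtain ⟨w, hw, ew⟩ := exists_eq_two_mul_of_lt_one hv.map_two (lt_of_le_of_ne hle hne)
  obtain ⟨i, j, k, z, hz, rfl⟩ := h.exists_bits X mX
  obtain ⟨rfl, rfl, rfl⟩ := eq_one_of_singular i j k (h.dvdBy_two _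
    (w - 2 * (ev η (ofBits i j k) - rootA η) * z - 2 * z ^ 2)
    (sub_mem (sub_mem hw (mul_mem (mul_mem h2 (sub_mem (h.ev_mem _) ma)) hz))
      (mul_mem h2 (pow_mem hz 2))) (by
    simp only [ev_sub, ev_mul hη, ev_rA, ev_rB, ev_rC]
    linear_combination ew))
  have one : ev η (ofBits true false false) = 1 := by simp [ev, ofBits]
  rw [one] at hXV
  have e1 := congrArg (ev η) deriv_eq
  have e2 := congrArg (ev η) value_eq
  have e3 := congrArg (ev η) sum_eq
  simp only [ev_add, ev_sub, ev_mul hη, ev_rA, ev_rB, ev_rC, ev_int] at e1 e2 e3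
  push_cast at e1 e2 e3
  obtain ⟨i, j, k, g, hg, rfl⟩ := h.exists_bits V mV
  obtain ⟨rfl, rfl, rfl⟩ := bits_of_sq_eq i j k (h.dvdBy_two _
    (z * (2 * ev η ⟨17, 8, -25⟩) + 2 * z ^ 2 * ev η ⟨-11, -1, 8⟩ + 4 * z ^ 3
      - 2 * ev η (ofBits i j k) * g - 2 * g ^ 2)
    (by
      repeat' first
        | exact hz | exact hg | exact h.ev_mem _ | exact ofNat_mem _ _
        | apply sub_mem | apply add_mem | apply mul_mem | apply pow_mem) (by
    simp only [ev_sub, ev_mul hη, ev_rA, ev_rB, ev_rC, ev_int]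
    push_cast
    linear_combination hXV + 2 * z * e1 - 4 * z ^ 2 * e3))
  have all : ev η (ofBits true true true) = ev η ⟨1, 1, 1⟩ := by simp [ev, ofBits]
  rw [all] at hXV
  have eq : g ^ 2 + ev η ⟨1, 1, 1⟩ * g = ev η ⟨-11, -1, 8⟩ * z ^ 2 + ev η ⟨17, 8, -25⟩ * z
      + ev η ⟨88, 128, -169⟩ + 2 * z ^ 3 := by
    apply mul_left_cancel₀ (by norm_num : (4 : L) ≠ 0)
    linear_combination hXV + 2 * z * e1 - 4 * z ^ 2 * e3 + e2
  obtain ⟨i, j, k, g', hg', rfl⟩ := h.exists_bits g hg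
  obtain ⟨i', j', k', z', hz', rfl⟩ := h.exists_bits z hz
  refine not_dvdBy_two_of_singular i j k i' j' k' (h.dvdBy_two _
    ((ev η (ofBits i' j' k') + 2 * z') ^ 3
      - (2 * ev η (ofBits i j k) * g' + 2 * g' ^ 2 + ev η ⟨1, 1, 1⟩ * g')
      + (ev η ⟨-11, -1, 8⟩ * (2 * ev η (ofBits i' j' k') * z' + 2 * z' ^ 2)
        + ev η ⟨17, 8, -25⟩ * z')) (by
      repeat' first
        | exact hz' | exact hg' | exact h.ev_mem _ | exact ofNat_mem _ _
        | apply sub_mem | apply add_mem | apply mul_mem | apply pow_mem) ?_)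
  simp only [ev_sub, ev_add, ev_mul hη]
  linear_combination eq

theorem OnCurve.dbl_sub [CharZero L] {X V : L} (h : OnCurve η X V) : dbl η X - rootA η =
    ((X - rootA η) ^ 2 - (rootA η - rootB η) * (rootA η - rootC η)) ^ 2 / (4 * V ^ 2) := by
  rw [dbl, dup_sub (by rw [← h.2]; exact pow_ne_zero 2 h.1), h.2]

theorem IsTwoAdic.map_dbl_of_one_lt [NumberField L] {v : Valuation L ℤᵐ⁰} (hv : IsTwoAdic η v)
    {X V : L} (h : OnCurve η X V) (hX : 1 < v X) : v (dbl η X) = v X * exp 2 := by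
  have hO := hv.twoIntegral
  have ma : v (rootA η) ≤ 1 := by rw [← ev_rA]; exact hO.ev_mem _
  have mb : v (rootB η) ≤ 1 := by rw [← ev_rB]; exact hO.ev_mem _
  have mc : v (rootC η) ≤ 1 := by rw [← ev_rC]; exact hO.ev_mem _
  have va : v (X - rootA η) = v X := v.map_sub_eq_of_lt_left (ma.trans_lt hX)
  have vb : v (X - rootB η) = v X := v.map_sub_eq_of_lt_left (mb.trans_lt hX)
  have vc : v (X - rootC η) = v X := v.map_sub_eq_of_lt_left (mc.trans_lt hX)
  have hX0 : v X ≠ 0 := (zero_lt_one.trans hX).ne'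
  have vn : v ((X - rootA η) ^ 2 - (rootA η - rootB η) * (rootA η - rootC η)) = v X ^ 2 := by
    rw [v.map_sub_eq_of_lt_left, map_pow, va]
    rw [map_mul, map_pow, va]
    calc v (rootA η - rootB η) * v (rootA η - rootC η) ≤ 1 * 1 :=
          mul_le_mul' (v.map_sub_le ma mb) (v.map_sub_le ma mc)
      _ < v X ^ 2 := by rw [mul_one]; exact one_lt_pow₀ hX two_ne_zero
  have v4 : v 4 = exp (-2 : ℤ) := by
    rw [show (4 : L) = 2 ^ 2 by norm_num, map_pow, hv.map_two, ← exp_nsmul]; rfl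
  have key : v (dbl η X - rootA η) = v X * exp 2 := by
    rw [h.dbl_sub, h.2, map_div₀, map_pow, vn, map_mul, map_mul, map_mul, va, vb, vc, v4,
      show (-2 : ℤ) = -(2 : ℤ) from rfl, exp_neg]
    field_simp
  have h1 : 1 < v X * exp 2 := by
    calc (1 : ℤᵐ⁰) = 1 * 1 := (mul_one 1).symm
      _ < v X * exp 2 := mul_lt_mul'' hX (by rw [← exp_zero, exp_lt_exp]; norm_num)
          zero_le_one zero_le_one
  rw [← key, ← v.map_add_eq_of_lt_left (x := dbl η X - rootA η) (y := rootA η),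
    sub_add_cancel]
  rw [key]
  exact ma.trans_lt h1

theorem IsTwoAdic.one_lt_map_dbl [NumberField L] {v : Valuation L ℤᵐ⁰}
    (hη : η ^ 3 + η ^ 2 - 2 * η - 1 = 0) (hv : IsTwoAdic η v)
    {X V : L} (h : OnCurve η X V) : 1 < v (dbl η X) := by
  have hexp : (1 : ℤᵐ⁰) < exp 2 := by rw [← exp_zero, exp_lt_exp]; norm_num
  rcases lt_or_ge 1 (v X) with hX | hX
  · rw [hv.map_dbl_of_one_lt h hX, ← mul_one (1 : ℤᵐ⁰)]
    exact mul_lt_mul'' hX hexp zero_le_one zero_le_one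
  · have hO := hv.twoIntegral
    have ma : v (rootA η) ≤ 1 := by rw [← ev_rA]; exact hO.ev_mem _
    have mb : v (rootB η) ≤ 1 := by rw [← ev_rB]; exact hO.ev_mem _
    have mc : v (rootC η) ≤ 1 := by rw [← ev_rC]; exact hO.ev_mem _
    have hV : v (V ^ 2) ≤ 1 := by
      rw [h.2, map_mul, map_mul]
      exact mul_le_one' (mul_le_one' (v.map_sub_le hX ma) (v.map_sub_le hX mb))
        (v.map_sub_le hX mc)
    have hV0 : 0 < v (V ^ 2) := by rw [Valuation.pos_iff]; exact pow_ne_zero 2 h.1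
    have v4 : v 4 < 1 := by
      rw [show (4 : L) = 2 ^ 2 by norm_num, map_pow, hv.map_two, ← exp_nsmul, ← exp_zero,
        exp_lt_exp]
      norm_num
    have v40 : 0 < v 4 := by rw [Valuation.pos_iff]; norm_num
    have key : 1 < v (dbl η X - rootA η) := by
      rw [h.dbl_sub, map_div₀, map_pow, hv.map_tangent_eq_one hη hX h.2, map_mul, one_pow,
        one_lt_div₀ (mul_pos v40 hV0)]
      calc v 4 * v (V ^ 2) ≤ v 4 * 1 := by gcongr
        _ < 1 := by rwa [mul_one]
    by_contra! hle
    exact absurd key (v.map_sub_le hle ma).not_gt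

/-- The elliptic curve has no points over the cubic field besides those of order at
most two. -/
theorem not_onCurve [NumberField L] [IsPrincipalIdealRing (𝓞 L)]
    (h3 : Module.finrank ℚ L = 3) (hη : IsIntegralCubicBasis η) (P : RealPlaces η) (X V : L) :
    ¬ OnCurve η X V := by
  obtain ⟨v, hv⟩ := hη.exists_isTwoAdic
  have hrel := hη.relation
  have descent (n : ℕ) : ∀ X V : L, OnCurve η X V → ¬ v (dbl η X) ≤ exp (n : ℤ) := by
    induction n with
    | zero => exact fun X V h hle => absurd (hv.one_lt_map_dbl hrel h) (by simpa using hle)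
    | succ n ih =>
      intro X V h hle
      obtain ⟨X', V', h', e, ⟨r, s, t, hr, hs, ht⟩ | ⟨r, s, t, hr, hs, ht⟩⟩ :=
        h.exists_twoDescent h3 hrel P
      · obtain ⟨hab, hac, hbc⟩ := P.root_ne
        obtain ⟨Y, W, hW, hY, hYX⟩ := exists_half hab hac hbc hr hs ht
        have hYW : OnCurve η Y W := ⟨hW, hY⟩
        replace hYX : dbl η Y = X' := hYX
        have h1 := hv.one_lt_map_dbl hrel hYW
        refine ih Y W hYW ?_
        rw [hYX] at h1 ⊢
        rw [← e, hv.map_dbl_of_one_lt h' h1] at hle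
        have h2 : v X' ≠ 0 := (zero_lt_one.trans h1).ne'
        rw [← exp_log h2] at hle ⊢
        rw [← exp_add, exp_le_exp] at hle
        rw [exp_le_exp]
        push_cast at hle
        linarith
      · exact hv.not_egg hrel hr hs ht
  intro h
  refine descent (log (v (dbl η X))).toNat X V h (le_exp_of_log_le ?_)
  exact Int.self_le_toNat _

end Descent

section SepticField

/-- Over the cubic field of conductor `7`, the elliptic curve has only points of order at most
two. -/
theorem exists_cubicField : ∃ (L : Type) (_ : Field L) (_ : NumberField L) (η : L),
    IsIntegralCubicBasis η ∧ ∀ X V : L, ¬ OnCurve η X V := by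
  have hirr : Irreducible (septicPoly.map (algebraMap ℤ ℚ)) :=
    (septicPoly_monic.irreducible_iff_irreducible_map_fraction_map (K := ℚ)).mp
      septicPoly_irreducible
  have : Fact (Irreducible (septicPoly.map (algebraMap ℤ ℚ))) := ⟨hirr⟩
  let B := AdjoinRoot.powerBasis hirr.ne_zero
  have : FiniteDimensional ℚ (AdjoinRoot (septicPoly.map (algebraMap ℤ ℚ))) := B.finite
  have : NumberField (AdjoinRoot (septicPoly.map (algebraMap ℤ ℚ))) := { }
  have hroot : aeval B.gen septicPoly = 0 := by
    rw [← aeval_map_algebraMap ℚ, AdjoinRoot.powerBasis_gen, aeval_def]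
    exact AdjoinRoot.eval₂_root _
  have hgen : IsIntegral ℤ B.gen := ⟨septicPoly, septicPoly_monic, hroot⟩
  have hB : minpoly ℤ B.gen = septicPoly := by
    refine eq_of_monic_of_associated (minpoly.monic hgen) septicPoly_monic ?_
    exact (minpoly.irreducible hgen).associated_of_dvd septicPoly_irreducible
      (minpoly.isIntegrallyClosed_dvd hgen hroot)
  have := isPrincipalIdealRing_ringOfIntegers B hB
  obtain ⟨P⟩ := nonempty_realPlaces B hB
  exact ⟨_, inferInstance, inferInstance, B.gen + 2, isIntegralCubicBasis_gen_add_two B hB,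
    not_onCurve (B.finrank.trans (dim_eq_three B hB)) (isIntegralCubicBasis_gen_add_two B hB) P⟩

end SepticField

section Chord

variable {M : Type*} [Field M]

/-- The residual intersection of the line `V = l * X + m` with the cubic. -/
theorem chord_vieta {a b c l m X₁ X₂ : M} (hX : X₁ ≠ X₂)
    (h₁ : (l * X₁ + m) ^ 2 = (X₁ - a) * (X₁ - b) * (X₁ - c))
    (h₂ : (l * X₂ + m) ^ 2 = (X₂ - a) * (X₂ - b) * (X₂ - c)) :
    X₁ * X₂ + (X₁ + X₂) * (l ^ 2 + a + b + c - (X₁ + X₂)) =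
        a * b + b * c + c * a - 2 * l * m ∧
      X₁ * X₂ * (l ^ 2 + a + b + c - (X₁ + X₂)) = a * b * c + m ^ 2 := by
  have h := sub_ne_zero.mpr hX
  constructor <;> refine mul_left_cancel₀ h ?_
  · linear_combination h₁ - h₂
  · linear_combination X₂ * h₁ - X₁ * h₂

theorem isogeny_eq {θ θb θc n u v w : M} (hw : w ≠ 0)
    (hb : n ^ 2 = (2 - θ) * (θb - θ)) (hc : n ^ 2 = (3 - θ) * (θc - θ))
    (h : (u * w + v) ^ 2 =
      -(w + θ - 2) * (w + θ - 3) * (w * (w + θ - θb) * (w + θ - θc))) :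
    ((u * w + v) * (w + n) / w ^ 2) ^ 2 = (-(w + n ^ 2 / w) - (2 * θ - 2 - θb)) *
      (-(w + n ^ 2 / w) - (2 * θ - 3 - θc)) * (-(w + n ^ 2 / w) - 2 * n) := by
  have e₁ : -(w + n ^ 2 / w) - (2 * θ - 2 - θb) = -((w + θ - 2) * (w + θ - θb)) / w := by
    field_simp; linear_combination -hb
  have e₂ : -(w + n ^ 2 / w) - (2 * θ - 3 - θc) = -((w + θ - 3) * (w + θ - θc)) / w := by
    field_simp; linear_combination -hc
  have e₃ : -(w + n ^ 2 / w) - 2 * n = -(w + n) ^ 2 / w := by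
    field_simp; ring
  rw [e₁, e₂, e₃, div_pow, mul_pow, h]
  field_simp

variable {L : Type*} [Field L] [CharZero L]

theorem sum_prod_of_chord (φ : L →+* M) {a b c n s q u v : L} {w₁ w₂ : M} (hw : w₁ ≠ w₂)
    (hs : w₁ + w₂ = φ s) (hq : w₁ * w₂ = φ q) (hq0 : q ≠ 0) (hqn : q ≠ n ^ 2)
    (hcurve : ∀ w, w = w₁ ∨ w = w₂ → ((φ u * w + φ v) * (w + φ n) / w ^ 2) ^ 2 =
      (-(w + φ n ^ 2 / w) - φ a) * (-(w + φ n ^ 2 / w) - φ b) * (-(w + φ n ^ 2 / w) - φ c))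
    (hno : ∀ X V : L, V ^ 2 = (X - a) * (X - b) * (X - c) → V = 0) :
    ∃ S Q : L, q * S = -(s * q + n ^ 2 * s) ∧
      q * Q = q ^ 2 + n ^ 2 * (s ^ 2 - 2 * q) + n ^ 4 ∧
      (a ^ 2 - S * a + Q = (a - b) * (a - c) ∨ b ^ 2 - S * b + Q = (b - a) * (b - c) ∨
        c ^ 2 - S * c + Q = (c - a) * (c - b)) := by
  have : CharZero M := (RingHom.charZero_iff φ.injective).mp inferInstance
  have hqM : w₁ * w₂ ≠ 0 := by rw [hq]; exact (map_ne_zero φ).mpr hq0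
  have hw₁ : w₁ ≠ 0 := left_ne_zero_of_mul hqM
  have hw₂ : w₂ ≠ 0 := right_ne_zero_of_mul hqM
  have hnM : w₁ * w₂ - φ n ^ 2 ≠ 0 := by
    rw [hq, ← map_pow, ← map_sub]; exact (map_ne_zero φ).mpr (sub_ne_zero.mpr hqn)
  have hqn' := sub_ne_zero.mpr hqn
  obtain ⟨l, hl₀⟩ : ∃ z : L, z = ((u * n + v) * q + v * n * s) / (q * (q - n ^ 2)) := ⟨_, rfl⟩
  obtain ⟨S, hS₀⟩ : ∃ z : L, z = -(s + n ^ 2 * s / q) := ⟨_, rfl⟩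
  obtain ⟨Q, hQ₀⟩ : ∃ z : L, z = q + n ^ 2 * (s ^ 2 - 2 * q) / q + n ^ 4 / q := ⟨_, rfl⟩
  obtain ⟨m, hm₀⟩ : ∃ z : L, z = ((2 * u * q ^ 2 + (u * n + v) * q * s
      + v * n * (s ^ 2 - 2 * q)) / q ^ 2 - l * S) / 2 := ⟨_, rfl⟩
  set X₁ := -(w₁ + φ n ^ 2 / w₁) with hX₁
  set X₂ := -(w₂ + φ n ^ 2 / w₂) with hX₂
  set V₁ := (φ u * w₁ + φ v) * (w₁ + φ n) / w₁ ^ 2 with hV₁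
  set V₂ := (φ u * w₂ + φ v) * (w₂ + φ n) / w₂ ^ 2 with hV₂
  have hl : φ l = ((φ u * φ n + φ v) * (w₁ * w₂) + φ v * φ n * (w₁ + w₂)) /
      (w₁ * w₂ * (w₁ * w₂ - φ n ^ 2)) := by
    simp only [hl₀, hs, hq, map_div₀, map_add, map_mul, map_sub, map_pow]
  have hS : φ S = X₁ + X₂ := by
    simp only [hS₀, map_neg, map_add, map_div₀, map_mul, map_pow, ← hs, ← hq, hX₁, hX₂]
    field_simp; ring
  have hQ : φ Q = X₁ * X₂ := by
    simp only [hQ₀, map_add, map_sub, map_div₀, map_mul, map_pow, ← hs, ← hq, hX₁, hX₂, map_ofNat]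
    field_simp; ring
  have hdiff : X₁ - X₂ = -(w₁ - w₂) * (w₁ * w₂ - φ n ^ 2) / (w₁ * w₂) := by
    rw [hX₁, hX₂]; field_simp; ring
  have hXne : X₁ ≠ X₂ := by
    rw [← sub_ne_zero, hdiff]
    exact div_ne_zero (mul_ne_zero (neg_ne_zero.mpr (sub_ne_zero.mpr hw)) hnM) hqM
  have hVd : V₁ - V₂ = φ l * (X₁ - X₂) := by
    rw [hl, hdiff, hV₁, hV₂]; field_simp; ring
  have hVs : V₁ + V₂ = φ (2 * m + l * S) := by
    have : 2 * m + l * S =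
        (2 * u * q ^ 2 + (u * n + v) * q * s + v * n * (s ^ 2 - 2 * q)) / q ^ 2 := by
      rw [hm₀]; ring
    rw [this]
    simp only [map_add, map_sub, map_div₀, map_mul, map_pow, ← hs, ← hq, hV₁, hV₂, map_ofNat]
    field_simp; ring
  rw [map_add, map_mul, map_mul, map_ofNat, hS] at hVs
  have h₁ : V₁ = φ l * X₁ + φ m := by linear_combination (hVd + hVs) / 2
  have h₂ : V₂ = φ l * X₂ + φ m := by linear_combination (hVs - hVd) / 2
  have c₁ := hcurve w₁ (.inl rfl)
  have c₂ := hcurve w₂ (.inr rfl)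
  rw [← hV₁, ← hX₁, h₁] at c₁
  rw [← hV₂, ← hX₂, h₂] at c₂
  obtain ⟨r₁, r₂⟩ := chord_vieta hXne c₁ c₂
  rw [← hS, ← hQ] at r₁ r₂
  have r₁' : Q + S * (l ^ 2 + a + b + c - S) = a * b + b * c + c * a - 2 * l * m := by
    apply φ.injective; simpa only [map_add, map_sub, map_mul, map_pow, map_ofNat] using r₁
  have r₂' : Q * (l ^ 2 + a + b + c - S) = a * b * c + m ^ 2 := by
    apply φ.injective; simpa only [map_add, map_sub, map_mul, map_pow, map_ofNat] using r₂
  generalize hX₃ : l ^ 2 + a + b + c - S = X₃ at r₁' r₂'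
  have hon : (l * X₃ + m) ^ 2 = (X₃ - a) * (X₃ - b) * (X₃ - c) := by
    linear_combination X₃ * r₁' - r₂' + X₃ ^ 2 * hX₃
  have hV₃ := hno _ _ hon
  refine ⟨S, Q, ?_, ?_, ?_⟩
  · rw [hS₀]; field_simp
  · rw [hQ₀]; field_simp
  rw [hV₃] at hon
  have : (X₃ - a) * (X₃ - b) * (X₃ - c) = 0 := by rw [← hon]; ring
  rcases mul_eq_zero.mp this with h | h
  · rcases mul_eq_zero.mp h with h | h
    · obtain rfl := sub_eq_zero.mp h
      left; linear_combination r₁' + 2 * X₃ * hX₃ - 2 * l * hV₃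
    · obtain rfl := sub_eq_zero.mp h
      right; left; linear_combination r₁' + 2 * X₃ * hX₃ - 2 * l * hV₃
  · obtain rfl := sub_eq_zero.mp h
    right; right; linear_combination r₁' + 2 * X₃ * hX₃ - 2 * l * hV₃

end Chord

section QuadraticPoints

variable {L : Type*} [Field L] [CharZero L] {η : L}

/-- The values `(B, C)` for which `X ^ 2 + B * X + C` carries one of the exceptional points. -/
def IsExceptional (B C : ℚ) : Prop :=
  (B = 5 ∧ C = -15) ∨ (B = 3 ∧ C = -19) ∨ (B = -5 ∧ C = 7) ∨ (B = -47 / 9 ∧ C = 59 / 9)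

theorem isExceptional_of_root (hη : IsIntegralCubicBasis η) {B C : ℚ} {s q n S Q : L}
    (hirr : ∀ r : ℚ, r ^ 2 + B * r + C ≠ 0)
    (hn : n = η ^ 2 - 2 * η) (hs : s = -B - 2 * (4 + η - 2 * η ^ 2))
    (hq : q = (4 + η - 2 * η ^ 2) ^ 2 + B * (4 + η - 2 * η ^ 2) + C)
    (hS : q * S = -(s * q + n ^ 2 * s))
    (hQ : q * Q = q ^ 2 + n ^ 2 * (s ^ 2 - 2 * q) + n ^ 4)
    (h : rootA η ^ 2 - S * rootA η + Q = (rootA η - rootB η) * (rootA η - rootC η) ∨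
      rootB η ^ 2 - S * rootB η + Q = (rootB η - rootA η) * (rootB η - rootC η) ∨
      rootC η ^ 2 - S * rootC η + Q = (rootC η - rootA η) * (rootC η - rootB η)) :
    IsExceptional B C := by
  have hm := hη.relation
  have clear {e d : L} (h : e ^ 2 - S * e + Q = d) :
      q * e ^ 2 + e * (s * q + n ^ 2 * s) +
        (q ^ 2 + n ^ 2 * (s ^ 2 - 2 * q) + n ^ 4) - q * d = 0 := by
    linear_combination q * h + e * hS - hQ
  simp only [rootA, rootB, rootC] at h
  subst hq hs hn
  rcases h with h | h | h
  · obtain ⟨h₁, h₂, h₃⟩ := hη.unique (2*B^2+3*B*C-8*B+C^2-C-25) (-6*B^2-3*B*C-69*B-26*C-120)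
      (-2*B^2-B*C-25*B-10*C-50) (by
        push_cast
        linear_combination clear h - (81*η^5-215*η^4-39*η^3*B-206*η^3+79*η^2*B+660*η^2-η*B^2
          +58*η*B+23*η*C+130*η+6*B^2-76*B-38*C-361) * hm)
    left
    have hC : C = -(30 + 6 * B) / 4 := by linear_combination (h₂ - 3 * h₃) / 4
    subst hC
    have : (B - 5) * (B + 10) = 0 := by linear_combination -2 * h₃
    rcases mul_eq_zero.mp this with h | h
    · obtain rfl := sub_eq_zero.mp h
      norm_num
    · obtain rfl := eq_neg_of_add_eq_zero_left h
      norm_num at h₁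
  · obtain ⟨h₁, h₂, h₃⟩ := hη.unique (-12*B^2-B*C-70*B+C^2-C-119) (6*B^2+2*B*C+38*B+6*C+60)
      (9*B^2+3*B*C+52*B+8*C+86) (by
        push_cast
        linear_combination clear h - (-63*η^5+109*η^4+45*η^3*B+160*η^3-44*η^2*B-162*η^2-9*η*B^2
          -111*η*B-9*η*C-270*η+8*B^2+54*B-6*C+57) * hm)
    right; left
    have hC : C = -4 - 5 * B := by linear_combination (3 * h₂ - 2 * h₃) / 2
    subst hC
    have : (B - 3) * (B + 3) = 0 := by linear_combination -h₂ / 4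
    rcases mul_eq_zero.mp this with h | h
    · obtain rfl := sub_eq_zero.mp h
      norm_num
    · obtain rfl := eq_neg_of_add_eq_zero_left h
      norm_num at h₁
  · obtain ⟨h₁, h₂, h₃⟩ := hη.unique (-11*B^2+8*B*C-36*B+C^2+79*C-175)
      (-21*B^2+6*B*C-69*B+104*C-264) (30*B^2-6*B*C+116*B-122*C+382) (by
        push_cast
        linear_combination clear h - (-99*η^5+359*η^4+36*η^3*B-16*η^3-121*η^2*B-888*η^2+9*η*B^2
          +60*η*B-27*η*C+366*η-27*B^2+16*B+92*C+289) * hm)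
    right; right; right
    have hC : C = (118 + 47 * B + 9 * B ^ 2) / 18 := by linear_combination (h₂ + h₃) / -18
    subst hC
    have : (9 * B + 47) * (3 * B + 16) * (B + 5) = 0 := by
      linear_combination 9 * h₂
    rcases mul_eq_zero.mp this with h | h
    · rcases mul_eq_zero.mp h with h | h
      · obtain rfl : B = -47 / 9 := by linarith
        norm_num
      · obtain rfl : B = -16 / 3 := by linarith
        norm_num at h₁
    · obtain rfl := eq_neg_of_add_eq_zero_left h
      exact absurd (by norm_num) (hirr 2)

/-- The genus two curve at the roots of `X ^ 2 + B * X + C`. -/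
theorem sq_eq_of_root {M : Type*} [Field M] {B C u v t : M} (ht : t ^ 2 + B * t + C = 0)
    (hl : -((B ^ 4 - 3 * B ^ 2 * C + C ^ 2) + 6 * (B ^ 3 - 2 * B * C) - 5 * (B ^ 2 - C)
      - 103 * B - 241) = 2 * u * v - u ^ 2 * B)
    (hc : -(C * (B ^ 3 - 2 * B * C) + 6 * C * (B ^ 2 - C) - 5 * B * C - 103 * C + 174) =
      v ^ 2 - u ^ 2 * C) :
    (u * t + v) ^ 2 = -(t - 2) * (t - 3) * (t ^ 3 - t ^ 2 - 16 * t + 29) := by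
  linear_combination (u ^ 2 + (t ^ 3 - (6 + B) * t ^ 2 + (B ^ 2 - C + 6 * B - 5) * t
    - (B ^ 3 - 2 * B * C + 6 * B ^ 2 - 6 * C - 5 * B - 103))) * ht - t * hl - hc

theorem isExceptional_of_coeffs {B C u v : ℚ} (hirr : ∀ r : ℚ, r ^ 2 + B * r + C ≠ 0)
    (hl : -((B ^ 4 - 3 * B ^ 2 * C + C ^ 2) + 6 * (B ^ 3 - 2 * B * C) - 5 * (B ^ 2 - C)
      - 103 * B - 241) = 2 * u * v - u ^ 2 * B)
    (hc : -(C * (B ^ 3 - 2 * B * C) + 6 * C * (B ^ 2 - C) - 5 * B * C - 103 * C + 174) =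
      v ^ 2 - u ^ 2 * C) : IsExceptional B C := by
  obtain ⟨L, _, _, η, hη, hno⟩ := exists_cubicField
  have hm := hη.relation
  have φ : L →+* AlgebraicClosure L := algebraMap L (AlgebraicClosure L)
  obtain ⟨n, hn⟩ : ∃ n, n = η ^ 2 - 2 * η := ⟨_, rfl⟩
  obtain ⟨θ, hθ⟩ : ∃ θ, θ = 4 + η - 2 * η ^ 2 := ⟨_, rfl⟩
  obtain ⟨q, hq⟩ : ∃ q, q = θ ^ 2 + B * θ + C := ⟨_, rfl⟩
  by_cases hqn : q = n ^ 2
  · obtain ⟨h₁, h₂, -⟩ := hη.unique (C + 4 * B + 13) (B + 5) (-2 * B - 10) (by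
      push_cast
      subst hn hq hθ
      linear_combination hqn - (3 * η - 3) * hm)
    right; right; left
    constructor <;> linarith
  have hq0 : q ≠ 0 := by
    intro h0
    obtain ⟨-, h₂, h₃⟩ := hη.unique (C + 4 * B + 8) (B - 4) (1 - 2 * B) (by
      push_cast
      subst hn hq hθ
      linear_combination h0 - (4 * η - 8) * hm)
    linarith
  obtain ⟨x₁, hx₁⟩ : ∃ t : AlgebraicClosure L, t ^ 2 + B * t + C = 0 := by
    obtain ⟨z, hz⟩ := IsAlgClosed.exists_pow_nat_eq ((B : AlgebraicClosure L) ^ 2 - 4 * C) two_pos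
    exact ⟨(-B + z) / 2, by linear_combination hz / 4⟩
  have hx₂ : (-B - x₁) ^ 2 + B * (-B - x₁) + C = 0 := by linear_combination hx₁
  have hne : x₁ - φ θ ≠ -B - x₁ - φ θ := by
    intro h
    have : x₁ = ((-B / 2 : ℚ) : AlgebraicClosure L) := by push_cast; linear_combination h / 2
    rw [this] at hx₁
    exact hirr (-B / 2) (by exact_mod_cast hx₁)
  have hlM : (_ : AlgebraicClosure L) = _ := congrArg (Rat.cast) hl
  have hcM : (_ : AlgebraicClosure L) = _ := congrArg (Rat.cast) hc
  push_cast at hlM hcM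
  obtain ⟨θb, hθb⟩ : ∃ z, z = 1 - 3 * η - η ^ 2 := ⟨_, rfl⟩
  obtain ⟨θc, hθc⟩ : ∃ z, z = -4 + 2 * η + 3 * η ^ 2 := ⟨_, rfl⟩
  have hnb : φ n ^ 2 = (2 - φ θ) * (φ θb - φ θ) := by
    have : n ^ 2 = (2 - θ) * (θb - θ) := by subst hn hθ hθb; linear_combination (6 - η) * hm
    simpa only [map_sub, map_mul, map_pow, map_ofNat] using congrArg φ this
  have hnc : φ n ^ 2 = (3 - φ θ) * (φ θc - φ θ) := by
    have : n ^ 2 = (3 - θ) * (θc - θ) := by subst hn hθ hθc; linear_combination (8 - 9 * η) * hm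
    simpa only [map_sub, map_mul, map_pow, map_ofNat] using congrArg φ this
  have ha : φ (rootA η) = 2 * φ θ - 2 - φ θb := by
    have : rootA η = 2 * θ - 2 - θb := by subst hθ hθb; rw [rootA]; ring
    simpa only [map_sub, map_mul, map_pow, map_ofNat] using congrArg φ this
  have hb : φ (rootB η) = 2 * φ θ - 3 - φ θc := by
    have : rootB η = 2 * θ - 3 - θc := by subst hθ hθc; rw [rootB]; ring
    simpa only [map_sub, map_mul, map_pow, map_ofNat] using congrArg φ this
  have hcn : φ (rootC η) = 2 * φ n := by
    have : rootC η = 2 * n := by subst hn; rw [rootC]; ring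
    simpa only [map_sub, map_mul, map_pow, map_ofNat] using congrArg φ this
  have hcub (t : AlgebraicClosure L) : t ^ 3 - t ^ 2 - 16 * t + 29 =
      (t - φ θ) * (t - φ θb) * (t - φ θc) := by
    have e₁ : θ + θb + θc = 1 := by subst hθ hθb hθc; ring
    have e₂ : θ * θb + θb * θc + θc * θ = -16 := by
      subst hθ hθb hθc; linear_combination -7 * η * hm
    have e₃ : θ * θb * θc = -29 := by
      subst hθ hθb hθc; linear_combination (6 * η ^ 3 + 13 * η ^ 2 - 26 * η - 13) * hm
    have f₁ := congrArg φ e₁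
    have f₂ := congrArg φ e₂
    have f₃ := congrArg φ e₃
    simp only [map_add, map_mul, map_neg, map_one, map_ofNat] at f₁ f₂ f₃
    linear_combination t ^ 2 * f₁ - t * f₂ + f₃
  have hcurve (t : AlgebraicClosure L) (ht : t ^ 2 + B * t + C = 0) (hw : t - φ θ ≠ 0) :=
    isogeny_eq (θ := φ θ) (u := (u : AlgebraicClosure L)) (v := u * φ θ + v) hw hnb hnc (by
      have := sq_eq_of_root ht hlM hcM
      rw [hcub] at this
      linear_combination this)
  have hprod : (x₁ - φ θ) * (-B - x₁ - φ θ) = φ q := by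
    rw [hq]
    simp only [map_add, map_mul, map_pow, map_ratCast]
    linear_combination -hx₁
  have hprod0 : (x₁ - φ θ) * (-B - x₁ - φ θ) ≠ 0 := by
    rw [hprod]; exact (map_ne_zero φ).mpr hq0
  obtain ⟨S, Q, hS, hQ, h⟩ := sum_prod_of_chord φ (a := rootA η) (b := rootB η) (c := rootC η)
    (n := n) (s := -B - 2 * θ) (q := q) (u := u) (v := u * θ + v) hne
    (by simp only [map_sub, map_neg, map_mul, map_ratCast, map_ofNat]; ring) hprod hq0 hqn
    (by
      simp only [map_add, map_mul, map_ratCast, ha, hb, hcn]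
      rintro w (rfl | rfl)
      · exact hcurve _ hx₁ (left_ne_zero_of_mul hprod0)
      · exact hcurve _ hx₂ (right_ne_zero_of_mul hprod0))
    (fun X V hV => by_contra fun h0 => hno X V ⟨h0, hV⟩)
  subst hθ
  exact isExceptional_of_root hη hirr hn rfl hq hS hQ h

end QuadraticPoints

section QuadraticField

theorem not_isSquare_eightyFive_rat : ¬ IsSquare (85 : ℚ) := by
  rw [show (85 : ℚ) = ((85 : ℕ) : ℚ) by norm_num, Rat.isSquare_natCast_iff]
  rintro ⟨r, hr⟩
  have : r ≤ 10 := by nlinarith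
  interval_cases r <;> omega

theorem not_exists_rat_of_sq_eq {K : Type*} [Field K] [CharZero K] {x : K} (a b d : ℚ)
    (hd : ¬ IsSquare d) (h : (a * x + b) ^ 2 = (d : K)) : ¬ ∃ q : ℚ, (q : K) = x := by
  rintro ⟨q, rfl⟩
  exact hd ⟨a * q + b, by rw [← sq]; exact_mod_cast h.symm⟩

theorem quadratic_relations {K : Type*} [Field K] [NumberField K]
    (hdeg : Module.finrank ℚ K = 2) {x : K} (hx : ¬ ∃ q : ℚ, (q : K) = x) :
    (∀ i j : ℚ, (i : K) + j * x = 0 → i = 0 ∧ j = 0) ∧ ∀ z : K, ∃ i j : ℚ, z = i + j * x := by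
  have huniq (i j : ℚ) (h : (i : K) + j * x = 0) : i = 0 ∧ j = 0 := by
    have hj : j = 0 := by
      by_contra hj
      refine hx ⟨-i / j, ?_⟩
      have : (j : K) ≠ 0 := by exact_mod_cast hj
      push_cast
      field_simp
      linear_combination -h
    subst hj
    exact ⟨by simpa using h, rfl⟩
  refine ⟨huniq, fun z => ?_⟩
  have hli : LinearIndependent ℚ ![(1 : K), x] := by
    rw [LinearIndependent.pair_iff]
    intro i j h
    exact huniq i j (by simpa [Algebra.smul_def] using h)
  have hspan := hli.span_eq_top_of_card_eq_finrank' (by simp [hdeg])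
  have hz : z ∈ Submodule.span ℚ (Set.range ![(1 : K), x]) := hspan ▸ Submodule.mem_top
  rw [Matrix.range_cons_cons_empty, Submodule.mem_span_pair] at hz
  obtain ⟨i, j, h⟩ := hz
  exact ⟨i, j, by simpa [Algebra.smul_def] using h.symm⟩

end QuadraticField

end

theorem nonobvious_quadratic_points_genus2 {K : Type*} [Field K] [NumberField K]
    (hdeg : Module.finrank ℚ K = 2) (x y : K) :
    (y ^ 2 = -(x - 2) * (x - 3) * (x ^ 3 - x ^ 2 - 16 * x + 29) ∧
        ¬∃ q : ℚ, (q : K) = x) ↔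
      ((x ^ 2 + 5 * x - 15 = 0 ∧ (y = 17 * x - 36 ∨ y = -(17 * x - 36))) ∨
       (x ^ 2 + 3 * x - 19 = 0 ∧ (y = 11 * x - 34 ∨ y = -(11 * x - 34))) ∨
       (x ^ 2 - 5 * x + 7 = 0 ∧ (y = 3 * x - 8 ∨ y = -(3 * x - 8))) ∨
       (9 * x ^ 2 - 47 * x + 59 = 0 ∧ (y = (x + 2) / 27 ∨ y = -((x + 2) / 27)))) := by
  simp only [← sq_eq_sq_iff_eq_or_eq_neg]
  constructor
  · rintro ⟨hy, hx⟩
    obtain ⟨huniq, hspan⟩ := quadratic_relations hdeg hx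
    obtain ⟨C, B, hBC⟩ : ∃ C B : ℚ, x ^ 2 + B * x + C = 0 := by
      obtain ⟨i, j, h⟩ := hspan (x ^ 2)
      exact ⟨-i, -j, by push_cast; linear_combination h⟩
    obtain ⟨v, u, rfl⟩ := hspan y
    have hirr (r : ℚ) : r ^ 2 + B * r + C ≠ 0 := by
      intro hr
      have hr' : (r : K) ^ 2 + B * r + C = 0 := by exact_mod_cast hr
      have : (x - r) * (x + r + B) = 0 := by linear_combination hBC - hr'
      rcases mul_eq_zero.mp this with h | h
      · exact hx ⟨r, by linear_combination -h⟩
      · exact hx ⟨-r - B, by push_cast; linear_combination -h⟩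
    obtain ⟨hc, hl⟩ := huniq
      (-(C * (B ^ 3 - 2 * B * C) + 6 * C * (B ^ 2 - C) - 5 * B * C - 103 * C + 174)
        - (v ^ 2 - u ^ 2 * C))
      (-((B ^ 4 - 3 * B ^ 2 * C + C ^ 2) + 6 * (B ^ 3 - 2 * B * C) - 5 * (B ^ 2 - C)
        - 103 * B - 241) - (2 * u * v - u ^ 2 * B)) (by
        push_cast
        linear_combination -hy + (u ^ 2 + (x ^ 3 - (6 + B) * x ^ 2
          + (B ^ 2 - C + 6 * B - 5) * x
          - (B ^ 3 - 2 * B * C + 6 * B ^ 2 - 6 * C - 5 * B - 103))) * hBC)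
    rcases isExceptional_of_coeffs hirr (sub_eq_zero.mp hl) (sub_eq_zero.mp hc) with
      ⟨rfl, rfl⟩ | ⟨rfl, rfl⟩ | ⟨rfl, rfl⟩ | ⟨rfl, rfl⟩ <;> push_cast at hBC
    · have h : x ^ 2 + 5 * x - 15 = 0 := by linear_combination hBC
      exact .inl ⟨h, by linear_combination hy + (-x ^ 3 + 11 * x ^ 2 - 65 * x + 98) * h⟩
    · have h : x ^ 2 + 3 * x - 19 = 0 := by linear_combination hBC
      exact .inr (.inl ⟨h, by linear_combination hy + (-x ^ 3 + 9 * x ^ 2 - 41 * x + 70) * h⟩)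
    · have h : x ^ 2 - 5 * x + 7 = 0 := by linear_combination hBC
      exact .inr (.inr (.inl ⟨h, by
        linear_combination hy + (-x ^ 3 + x ^ 2 + 17 * x - 34) * h⟩))
    · have h : 9 * x ^ 2 - 47 * x + 59 = 0 := by linear_combination 9 * hBC
      exact .inr (.inr (.inr ⟨h, by
        linear_combination hy + (-x ^ 3 / 9 + 7 * x ^ 2 / 81 + 1265 * x / 729 - 2150 / 729) * h⟩))
  · rintro (⟨h, hy⟩ | ⟨h, hy⟩ | ⟨h, hy⟩ | ⟨h, hy⟩)
    · refine ⟨by linear_combination hy - (-x ^ 3 + 11 * x ^ 2 - 65 * x + 98) * h,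
        not_exists_rat_of_sq_eq 2 5 85 not_isSquare_eightyFive_rat ?_⟩
      push_cast; linear_combination 4 * h
    · refine ⟨by linear_combination hy - (-x ^ 3 + 9 * x ^ 2 - 41 * x + 70) * h,
        not_exists_rat_of_sq_eq 2 3 85 not_isSquare_eightyFive_rat ?_⟩
      push_cast; linear_combination 4 * h
    · refine ⟨by linear_combination hy - (-x ^ 3 + x ^ 2 + 17 * x - 34) * h,
        not_exists_rat_of_sq_eq 2 (-5) (-3)
          (fun hs => absurd hs.nonneg (by norm_num)) ?_⟩
      push_cast; linear_combination 4 * h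
    · refine ⟨by linear_combination hy - (-x ^ 3 / 9 + 7 * x ^ 2 / 81 + 1265 * x / 729
          - 2150 / 729) * h,
        not_exists_rat_of_sq_eq 18 (-47) 85 not_isSquare_eightyFive_rat ?_⟩
      push_cast; linear_combination 36 * h
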